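/- arXiv:math/0404289 — 2 statements merged into one kernel-verified Lean document; each statement's English description precedes it below -/
import Mathlib

section
/- For every natural number k there exist constants c_k > 0 and C_k > 0 such that for all sufficiently large T and all G with C_k log log T ≤ G ≤ T, one has ∫_{T−G}^{T+G} |ζ(1/2 + it)|^{2k} dt ≥ c_k G (log G)^{k²}. -/
open Real MeasureTheory

/-- the k-fold divisor function -/
noncomputable def rdv (k n : ℕ) : ℕ := (ArithmeticFunction.zeta ^ k) n

lemma rdv_zero (n : ℕ) : rdv 0 n = if n = 1 then 1 else 0 := by
  simp [rdv, ArithmeticFunction.one_apply]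

lemma rdv_at_zero (k : ℕ) : rdv k 0 = 0 := by simp [rdv]

lemma rdv_one (k : ℕ) : rdv k 1 = 1 :=
  (ArithmeticFunction.isMultiplicative_zeta.pow (k := k)).map_one

lemma rdv_succ (k n : ℕ) : rdv (k+1) n = ∑ i ∈ n.divisors, rdv k i := by
  simp only [rdv]; rw [pow_succ, ArithmeticFunction.mul_zeta_apply]

lemma rdv_add (k l n : ℕ) :
    rdv (k+l) n = ∑ p ∈ n.divisorsAntidiagonal, rdv k p.1 * rdv l p.2 := by
  simp only [rdv]; rw [pow_add, ArithmeticFunction.mul_apply]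

open scoped Pointwise in
lemma rdv_submul (k m n : ℕ) : rdv k (m*n) ≤ rdv k m * rdv k n := by
  induction k generalizing m n with
  | zero => simp only [rdv_zero, mul_eq_one]; split_ifs <;> simp_all
  | succ k ih =>
    rw [rdv_succ, rdv_succ, rdv_succ, Nat.divisors_mul, Finset.sum_mul_sum, ← Finset.sum_product']
    calc ∑ i ∈ m.divisors * n.divisors, rdv k i
        ≤ ∑ p ∈ m.divisors ×ˢ n.divisors, rdv k (p.1 * p.2) := by
          rw [Finset.mul_def]
          exact Finset.sum_image_le_of_nonneg (g := fun p : ℕ × ℕ => p.1 * p.2) (f := rdv k) (by simp)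
      _ ≤ _ := Finset.sum_le_sum fun p _ => ih _ _

lemma rdv_mul_le (k l n : ℕ) : rdv k n * rdv l n ≤ rdv (k*l) n := by
  induction k generalizing n with
  | zero => 
    simp only [rdv_zero, zero_mul]; split_ifs with h
    · subst h; simp [rdv_one]
    · simp
  | succ k ih =>
    rw [rdv_add, add_mul, one_mul, rdv_add, Finset.sum_mul]
    refine Finset.sum_le_sum fun p hp => ?_
    rw [Nat.mem_divisorsAntidiagonal] at hp
    have h1 : rdv 1 p.2 = 1 := by
      have : p.2 ≠ 0 := by rintro h; simp [h] at hp; omega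
      simp [rdv, this]
    rw [h1, ← hp.1, mul_one]
    calc rdv k p.1 * rdv l (p.1*p.2) ≤ rdv k p.1 * (rdv l p.1 * rdv l p.2) :=
          Nat.mul_le_mul_left _ (rdv_submul _ _ _)
      _ = (rdv k p.1 * rdv l p.1) * rdv l p.2 := by ring
      _ ≤ _ := Nat.mul_le_mul_right _ (ih _)

lemma rdv_le_mul_sqf (k l n : ℕ) (hn : Squarefree n) : rdv (k*l) n ≤ rdv k n * rdv l n := by
  induction k generalizing n with
  | zero => 
    simp only [rdv_zero, zero_mul]; split_ifs with h
    · subst h; simp [rdv_one]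
    · simp
  | succ k ih =>
    rw [rdv_add k 1, add_mul, one_mul, rdv_add, Finset.sum_mul]
    refine Finset.sum_le_sum fun p hp => ?_
    rw [Nat.mem_divisorsAntidiagonal] at hp
    have h1 : rdv 1 p.2 = 1 := by
      have : p.2 ≠ 0 := by rintro h; simp [h] at hp; omega
      simp [rdv, this]
    have hsq : Squarefree (p.1 * p.2) := by rw [hp.1]; exact hn
    have hm : rdv l (p.1*p.2) = rdv l p.1 * rdv l p.2 :=
      (ArithmeticFunction.isMultiplicative_zeta.pow (k := l)).map_mul_of_coprime
        (Nat.coprime_of_squarefree_mul hsq)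
    rw [h1, ← hp.1, mul_one, hm, ← mul_assoc]
    exact Nat.mul_le_mul_right _ (ih _ (hsq.of_mul_left))

lemma rdv_LSeries (k : ℕ) {s : ℂ} (hs : 1 < s.re) :
    LSeriesHasSum (fun n => (rdv k n : ℂ)) s (riemannZeta s ^ k) := by
  induction k with
  | zero =>
    have : (fun n => (rdv 0 n : ℂ)) = LSeries.delta := by
      ext n; simp only [rdv_zero, LSeries.delta]; split_ifs <;> simp
    rw [this, pow_zero]
    have : LSeriesSummable LSeries.delta s := by
      refine summable_of_ne_finset_zero (s := {1}) ?_
      intro b hb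
      simp only [Finset.mem_singleton] at hb
      simp [LSeries.term, LSeries.delta, hb]
    have h := this.LSeriesHasSum
    rwa [show LSeries LSeries.delta s = 1 by simp [LSeries_delta]] at h
  | succ k ih =>
    have h2 := ArithmeticFunction.LSeriesHasSum_zeta hs
    have h3 := ih.convolution h2
    rw [pow_succ]
    convert h3 using 1
    ext n
    rw [LSeries.convolution_def, rdv_add]
    push_cast
    refine Finset.sum_congr rfl fun p hp => ?_
    simp [rdv]

lemma rdv_summable (k : ℕ) {σ : ℝ} (hσ : 1 < σ) :
    Summable (fun n : ℕ => (rdv k n : ℝ) * (n:ℝ) ^ (-σ)) := by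
  have h := (rdv_LSeries k (s := (σ:ℂ)) (by simpa using hσ)).LSeriesSummable
  have := h.norm
  refine this.congr fun n => ?_
  rw [LSeries.norm_term_eq]
  split_ifs with h0
  · simp [h0, rdv_at_zero]
  · rw [Real.rpow_neg (by positivity)]; simp [div_eq_mul_inv]

lemma rdv_harm (M K : ℕ) :
    (∑ n ∈ Finset.Icc 1 M, (1:ℝ)/n)^K ≤ ∑ n ∈ Finset.Icc 1 (M^K), (rdv K n : ℝ) / n := by
  induction K with
  | zero => simp [rdv_one]
  | succ K ih =>
    rw [pow_succ]
    calc _ ≤ (∑ n ∈ Finset.Icc 1 (M^K), (rdv K n : ℝ) / n) * (∑ n ∈ Finset.Icc 1 M, (1:ℝ)/n) := by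
          gcongr
      _ = ∑ p ∈ Finset.Icc 1 (M^K) ×ˢ Finset.Icc 1 M, (rdv K p.1 : ℝ) / (p.1 * p.2 : ℕ) := by
          rw [Finset.sum_mul_sum, ← Finset.sum_product']
          refine Finset.sum_congr rfl fun p _ => ?_
          push_cast; rw [div_mul_div_comm, mul_one]
      _ = ∑ n ∈ Finset.Icc 1 (M^(K+1)), ∑ p ∈ Finset.Icc 1 (M^K) ×ˢ Finset.Icc 1 M with p.1 * p.2 = n,
            (rdv K p.1 : ℝ) / (p.1 * p.2 : ℕ) := by
          rw [Finset.sum_fiberwise_of_maps_to]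
          intro p hp
          simp only [Finset.mem_product, Finset.mem_Icc] at hp ⊢
          exact ⟨Nat.mul_pos (by omega) (by omega), by rw [pow_succ]; exact Nat.mul_le_mul hp.1.2 hp.2.2⟩
      _ ≤ _ := by
          refine Finset.sum_le_sum fun n hn => ?_
          rw [rdv_add]
          push_cast
          rw [Finset.sum_div]
          have hn' := (Finset.mem_Icc.1 hn).1
          refine le_trans (Finset.sum_le_sum_of_subset_of_nonneg (t := n.divisorsAntidiagonal) ?_ ?_) ?_
          · intro p hp
            simp only [Finset.mem_filter, Nat.mem_divisorsAntidiagonal] at hp ⊢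
            exact ⟨hp.2, by omega⟩
          · intros; positivity
          · refine Finset.sum_le_sum fun p hp => ?_
            rw [Nat.mem_divisorsAntidiagonal] at hp
            have h1 : rdv 1 p.2 = 1 := by
              have : p.2 ≠ 0 := by rintro h; simp [h] at hp; omega
              simp [rdv, this]
            rw [h1, ← Nat.cast_mul, hp.1]; simp

lemma rdv_sq_compare (k : ℕ) : ∃ Z : ℝ, 0 < Z ∧ ∀ N : ℕ,
    ∑ n ∈ Finset.Icc 1 N, (rdv (k^2) n : ℝ)/n ≤
      Z * ∑ n ∈ Finset.Icc 1 N, (rdv k n : ℝ)^2/n := by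
  set K := k^2 with hK
  have hsum := rdv_summable (K*K) (σ := 2) (by norm_num)
  refine ⟨1 + ∑' n : ℕ, (rdv (K*K) n : ℝ) * (n:ℝ) ^ (-2:ℝ), ?_, fun N => ?_⟩
  · have : 0 ≤ ∑' n : ℕ, (rdv (K*K) n : ℝ) * (n:ℝ) ^ (-2:ℝ) := tsum_nonneg fun n => by positivity
    linarith
  choose a b hab hsq using Nat.sq_mul_squarefree
  have hpos : ∀ n, 1 ≤ n → 1 ≤ a n ∧ 1 ≤ b n := by
    intro n hn
    have := hab n
    constructor <;> rw [Nat.one_le_iff_ne_zero] <;> intro h <;> simp [h] at this <;> omega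
  have hB : ∑ n ∈ Finset.Icc 1 N, (rdv K n : ℝ)^2/(n:ℝ)^2 ≤
      1 + ∑' n : ℕ, (rdv (K*K) n : ℝ) * (n:ℝ) ^ (-2:ℝ) := by
    have h1 := hsum.sum_le_tsum (Finset.Icc 1 N) (fun n _ => by positivity)
    refine le_trans (Finset.sum_le_sum fun n hn => ?_) (h1.trans (by linarith))
    have : (rdv K n : ℝ)^2 ≤ rdv (K*K) n := by
      rw [sq]; exact_mod_cast rdv_mul_le K K n
    have h2 : (n:ℝ) ^ (-2:ℝ) = ((n:ℝ)^2)⁻¹ := by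
      rw [Real.rpow_neg (by positivity)]; norm_num
    rw [h2, div_eq_mul_inv]
    gcongr
  calc _ ≤ ∑ n ∈ Finset.Icc 1 N, ((rdv K (b n) : ℝ)^2/(b n:ℝ)^2) * ((rdv k (a n) : ℝ)^2/(a n)) := by
        refine Finset.sum_le_sum fun n hn => ?_
        have h1 : rdv K n ≤ rdv K (b n) ^2 * rdv k (a n)^2 := by
          calc rdv K n = rdv K (b n * b n * a n) := by rw [← sq, hab]
            _ ≤ rdv K (b n * b n) * rdv K (a n) := rdv_submul _ _ _
            _ ≤ (rdv K (b n) * rdv K (b n)) * (rdv k (a n) * rdv k (a n)) := by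
              refine Nat.mul_le_mul (rdv_submul _ _ _) ?_
              rw [hK, sq]
              exact rdv_le_mul_sqf _ _ _ (hsq n)
            _ = _ := by ring
        have h2 : (n:ℝ) = (b n:ℝ)^2 * a n := by exact_mod_cast (hab n).symm
        rw [div_mul_div_comm, ← h2]
        gcongr
        exact_mod_cast h1
    _ = ∑ p ∈ (Finset.Icc 1 N).image (fun n => (b n, a n)), ((rdv K p.1 : ℝ)^2/(p.1:ℝ)^2) * ((rdv k p.2 : ℝ)^2/p.2) := by
        rw [Finset.sum_image]
        intro x _ y _ hxy
        simp only [Prod.mk.injEq] at hxy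
        rw [← hab x, ← hab y, hxy.1, hxy.2]
    _ ≤ ∑ p ∈ Finset.Icc 1 N ×ˢ Finset.Icc 1 N, ((rdv K p.1 : ℝ)^2/(p.1:ℝ)^2) * ((rdv k p.2 : ℝ)^2/p.2) := by
        refine Finset.sum_le_sum_of_subset_of_nonneg ?_ (fun _ _ _ => by positivity)
        intro p hp
        obtain ⟨n, hn, rfl⟩ := Finset.mem_image.1 hp
        simp only [Finset.mem_product, Finset.mem_Icc] at hn ⊢
        obtain ⟨h1, h2⟩ := hpos n hn.1
        have := hab n
        refine ⟨⟨h2, (Nat.le_of_dvd (by omega) ?_).trans hn.2⟩, ⟨h1, (Nat.le_of_dvd (by omega) ?_).trans hn.2⟩⟩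
        · exact ⟨b n * a n, by rw [← mul_assoc, ← sq]; exact this.symm⟩
        · exact ⟨b n ^2, by rw [mul_comm]; exact this.symm⟩
    _ = (∑ n ∈ Finset.Icc 1 N, (rdv K n : ℝ)^2/(n:ℝ)^2) * ∑ n ∈ Finset.Icc 1 N, (rdv k n : ℝ)^2/n := by
        rw [Finset.sum_mul_sum, ← Finset.sum_product']
    _ ≤ _ := by
        gcongr

lemma rdv_lower (k : ℕ) : ∃ z : ℝ, 0 < z ∧ ∀ M : ℕ,
    z * Real.log (M+1) ^ (k^2) ≤ ∑ n ∈ Finset.Icc 1 (M^(k^2)), (rdv k n : ℝ)^2/n := by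
  obtain ⟨Z, hZ, h⟩ := rdv_sq_compare k
  refine ⟨Z⁻¹, by positivity, fun M => ?_⟩
  rw [inv_mul_le_iff₀ hZ]
  refine le_trans ?_ ((rdv_harm M (k^2)).trans (h _))
  have h0 : 0 ≤ Real.log (M+1) := Real.log_nonneg (by linarith [(Nat.cast_nonneg M : (0:ℝ) ≤ M)])
  gcongr
  have := log_add_one_le_harmonic M
  rw [harmonic_eq_sum_Icc] at this
  push_cast at this
  simpa using this

noncomputable def zterm (n : ℕ) (s : ℂ) : ℂ :=
  ((n:ℂ)+1)^(-s) - (((n:ℂ)+2)^(1-s) - ((n:ℂ)+1)^(1-s))/(1-s)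

lemma zterm_norm (n : ℕ) {s : ℂ} (hs0 : 0 < s.re) (hs1 : s ≠ 1) :
    ‖zterm n s‖ ≤ ‖s‖ * ((n:ℝ)+1)^(-s.re-1) := by
  have hsn : s ≠ 0 := by rintro rfl; simp at hs0
  have hsub : (1 - s) ≠ 0 := sub_ne_zero.2 (Ne.symm hs1)
  set C := ‖s‖ * ((n:ℝ)+1)^(-s.re-1) with hC
  set S : Set ℝ := Set.Icc ((n:ℝ)+1) ((n:ℝ)+2) with hS
  have hl : ((n:ℝ)+1) ∈ S := ⟨le_rfl, by linarith⟩
  have hr : ((n:ℝ)+2) ∈ S := ⟨by linarith, le_rfl⟩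
  have hpos : ∀ x ∈ S, 0 < x := fun x hx => lt_of_lt_of_le (by positivity) hx.1
  have h1 : ∀ x ∈ S, ‖(x:ℂ)^(-s) - (((n:ℝ)+1 : ℝ):ℂ)^(-s)‖ ≤ C := by
    intro x hx
    have hd : ∀ y ∈ S, HasDerivWithinAt (fun y : ℝ => (y:ℂ)^(-s)) ((-s) * (y:ℂ)^(-s-1)) S y := by
      intro y hy
      have := hasDerivAt_ofReal_cpow_const (x := y) (hpos y hy).ne' (r := -s)
        (neg_ne_zero.2 hsn)
      exact this.hasDerivWithinAt
    have hb : ∀ y ∈ S, ‖(-s) * (y:ℂ)^(-s-1)‖ ≤ C := by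
      intro y hy
      rw [norm_mul, norm_neg, Complex.norm_cpow_eq_rpow_re_of_pos (hpos y hy), hC]
      gcongr
      simp only [Complex.sub_re, Complex.neg_re, Complex.one_re]
      exact Real.rpow_le_rpow_of_nonpos (by positivity) hy.1 (by linarith)
    refine ((convex_Icc _ _).norm_image_sub_le_of_norm_hasDerivWithin_le hd hb hl hx).trans ?_
    have : ‖x - ((n:ℝ)+1)‖ ≤ 1 := by
      rw [Real.norm_eq_abs, abs_le]; constructor <;> linarith [hx.1, hx.2]
    have hC0 : 0 ≤ C := by positivity
    nlinarith
  have hd : ∀ y ∈ S, HasDerivWithinAt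
      (fun y : ℝ => (y:ℂ) * (((n:ℝ)+1 : ℝ):ℂ)^(-s) - (y:ℂ)^(1-s)/(1-s))
      ((((n:ℝ)+1 : ℝ):ℂ)^(-s) - (y:ℂ)^(-s)) S y := by
    intro y hy
    have h2 := hasDerivAt_ofReal_cpow_const' (x := y) (hpos y hy).ne' (r := -s)
        (by intro h; apply hs1; linear_combination -h)
    rw [show -s + 1 = 1 - s by ring] at h2
    have h3 := (HasDerivAt.ofReal_comp (hasDerivAt_id y)).mul_const ((((n:ℝ)+1 : ℝ):ℂ)^(-s))
    simp only [id, Complex.ofReal_one, one_mul] at h3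
    exact (h3.sub h2).hasDerivWithinAt
  have := (convex_Icc _ _).norm_image_sub_le_of_norm_hasDerivWithin_le hd
    (fun y hy => by rw [norm_sub_rev]; exact h1 y hy) hl hr
  have e : ‖((n:ℝ)+2) - ((n:ℝ)+1)‖ = 1 := by
    rw [show ((n:ℝ)+2) - ((n:ℝ)+1) = 1 by ring]; simp
  rw [e, mul_one] at this
  refine le_trans (le_of_eq ?_) this
  congr 1
  unfold zterm; push_cast; ring

lemma zterm_hasSum {s : ℂ} (hs : 1 < s.re) :
    HasSum (fun n => zterm n s) (riemannZeta s - 1/(s-1)) := by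
  have hs1 : s ≠ 1 := by rintro rfl; simp at hs
  have hsum : Summable (fun n => zterm n s) := by
    refine Summable.of_norm_bounded (g := fun n : ℕ => ‖s‖ * ((n:ℝ)+1)^(-s.re-1)) ?_
      (fun n => zterm_norm n (by linarith) hs1)
    refine Summable.mul_left _ ?_
    have := (summable_nat_add_iff 1).2 (Real.summable_nat_rpow (p := -s.re-1).2 (by linarith))
    simpa using this
  have hz : HasSum (fun n : ℕ => ((n:ℂ)+1)^(-s)) (riemannZeta s) := by
    rw [zeta_eq_tsum_one_div_nat_add_one_cpow hs]
    have : Summable (fun n : ℕ => 1 / ((n:ℂ)+1)^s) := by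
      have := (summable_nat_add_iff 1).2 (Complex.summable_one_div_nat_cpow.2 hs)
      simpa using this
    simpa [Complex.cpow_neg] using this.hasSum
  have h2 := hsum.hasSum.tendsto_sum_nat
  have h3 := hz.tendsto_sum_nat
  have h4 : Filter.Tendsto (fun N : ℕ => ((N:ℂ)+1)^(1-s)) Filter.atTop (nhds 0) := by
    rw [tendsto_zero_iff_norm_tendsto_zero]
    have h5 : Filter.Tendsto (fun N : ℕ => ((N:ℝ)+1)^(-(s.re - 1))) Filter.atTop (nhds 0) :=
      (tendsto_rpow_neg_atTop (by linarith)).comp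
        (Filter.tendsto_atTop_add_const_right _ _ tendsto_natCast_atTop_atTop)
    refine h5.congr fun N => ?_
    have := Complex.norm_cpow_eq_rpow_re_of_pos (x := (N:ℝ)+1) (by positivity) (1-s)
    push_cast at this
    rw [this]; simp
  have h6 : ∀ N : ℕ, ∑ n ∈ Finset.range N, zterm n s =
      ∑ n ∈ Finset.range N, ((n:ℂ)+1)^(-s) - (((N:ℂ)+1)^(1-s) - 1)/(1-s) := by
    intro N
    induction N with
    | zero => simp
    | succ N ih => 
      rw [Finset.sum_range_succ, Finset.sum_range_succ, ih, zterm]; push_cast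
      rw [show (N:ℂ)+1+1 = N+2 by ring]; ring
  have h7 : Filter.Tendsto (fun N : ℕ => ∑ n ∈ Finset.range N, zterm n s) Filter.atTop
      (nhds (riemannZeta s - ((0:ℂ) - 1)/(1-s))) := by
    simp_rw [h6]
    exact h3.sub ((h4.sub_const 1).div_const _)
  have h8 := tendsto_nhds_unique h2 h7
  have := hsum.hasSum
  rw [h8] at this
  convert this using 2
  have : s - 1 ≠ 0 := sub_ne_zero.2 hs1
  have : 1 - s ≠ 0 := sub_ne_zero.2 hs1.symm
  field_simp; ring

lemma zeta_eq_zterm {s : ℂ} (h1 : 1/2 ≤ s.re) (h2 : s.re ≤ 2) (h3 : 0 < s.im) :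
    riemannZeta s = (∑' n, zterm n s) + 1/(s-1) := by
  set U : Set ℂ := (Complex.re ⁻¹' Set.Ioo (1/4) 3) ∩ (Complex.im ⁻¹' Set.Ioo 0 (s.im+1)) with hU
  have hUo : IsOpen U := (isOpen_Ioo.preimage Complex.continuous_re).inter
    (isOpen_Ioo.preimage Complex.continuous_im)
  have hUc : Convex ℝ U := ((convex_Ioo _ _).linear_preimage Complex.reLm).inter
    ((convex_Ioo _ _).linear_preimage Complex.imLm)
  have hne : ∀ w ∈ U, w ≠ 1 := by
    rintro w hw rfl; simp [hU] at hw
  have hdz : ∀ n, DifferentiableOn ℂ (zterm n) U := by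
    intro n w hw
    have : (1 - w) ≠ 0 := sub_ne_zero.2 (hne w hw).symm
    have a1 : (n:ℂ)+1 ≠ 0 := by exact_mod_cast n.succ_ne_zero
    have a2 : (n:ℂ)+2 ≠ 0 := by exact_mod_cast (n+1).succ_ne_zero
    unfold zterm
    refine DifferentiableAt.differentiableWithinAt ?_
    refine DifferentiableAt.sub ?_ (DifferentiableAt.div (DifferentiableAt.sub ?_ ?_) ?_ this)
    · exact DifferentiableAt.const_cpow (by fun_prop) (Or.inl a1)
    · exact DifferentiableAt.const_cpow (by fun_prop) (Or.inl a2)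
    · exact DifferentiableAt.const_cpow (by fun_prop) (Or.inl a1)
    · fun_prop
  have hsm : Summable (fun n : ℕ => (3 + (s.im+1)) * ((n:ℝ)+1)^(-(5/4:ℝ))) := by
    refine Summable.mul_left _ ?_
    have := (summable_nat_add_iff 1).2 (Real.summable_nat_rpow (p := -(5/4:ℝ)).2 (by norm_num))
    simpa using this
  have hd1 : DifferentiableOn ℂ (fun w => ∑' n, zterm n w) U := by
    refine Complex.differentiableOn_tsum_of_summable_norm hsm hdz hUo ?_
    intro n w hw
    refine (zterm_norm n (by linarith [hw.1.1]) (hne w hw)).trans ?_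
    gcongr
    · refine (Complex.norm_le_abs_re_add_abs_im w).trans ?_
      rw [abs_of_pos (by linarith [hw.1.1]), abs_of_pos hw.2.1]
      linarith [hw.1.2, hw.2.2]
    · linarith [(Nat.cast_nonneg n : (0:ℝ) ≤ n)]
    · linarith [hw.1.1]
  have hf : AnalyticOnNhd ℂ (fun w => (∑' n, zterm n w) + 1/(w-1)) U := by
    refine DifferentiableOn.analyticOnNhd ?_ hUo
    refine hd1.add ?_
    refine DifferentiableOn.div (by fun_prop) (by fun_prop) ?_
    intro w hw; exact sub_ne_zero.2 (hne w hw)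
  have hg : AnalyticOnNhd ℂ riemannZeta U := by
    refine DifferentiableOn.analyticOnNhd ?_ hUo
    intro w hw; exact (differentiableAt_riemannZeta (hne w hw)).differentiableWithinAt
  have hp : (⟨2, s.im/2⟩ : ℂ) ∈ U := by
    simp only [hU, Set.mem_inter_iff, Set.mem_preimage, Set.mem_Ioo]
    refine ⟨⟨by norm_num, by norm_num⟩, ⟨by linarith, by linarith⟩⟩
  have hev : riemannZeta =ᶠ[nhds (⟨2, s.im/2⟩ : ℂ)] (fun w => (∑' n, zterm n w) + 1/(w-1)) := by
    have : {w : ℂ | 1 < w.re} ∈ nhds (⟨2, s.im/2⟩ : ℂ) :=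
      (isOpen_lt continuous_const Complex.continuous_re).mem_nhds (by norm_num)
    filter_upwards [this] with w hw
    rw [(zterm_hasSum hw).tsum_eq]; ring
  refine hg.eqOn_of_preconnected_of_eventuallyEq hf hUc.isPreconnected hp hev ?_
  simp only [hU, Set.mem_inter_iff, Set.mem_preimage, Set.mem_Ioo]
  refine ⟨⟨by linarith, by linarith⟩, ⟨by linarith, by linarith⟩⟩

lemma zeta_growth : ∃ B : ℝ, 1 ≤ B ∧ ∀ s : ℂ, 1/2 ≤ s.re → s.re ≤ 2 → 1 ≤ s.im →
    ‖riemannZeta s‖ ≤ B * s.im := by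
  have hsm : Summable (fun n : ℕ => ((n:ℝ)+1)^(-(3/2:ℝ))) := by
    have := (summable_nat_add_iff 1).2 (Real.summable_nat_rpow (p := -(3/2:ℝ)).2 (by norm_num))
    simpa using this
  set Q := ∑' n : ℕ, ((n:ℝ)+1)^(-(3/2:ℝ)) with hQ
  have hQ0 : 0 ≤ Q := tsum_nonneg fun n => by positivity
  refine ⟨3*Q+1, by linarith, fun s h1 h2 h3 => ?_⟩
  have hs1 : s ≠ 1 := by rintro rfl; simp at h3; linarith
  rw [zeta_eq_zterm h1 h2 (by linarith)]
  have hn : ‖s‖ ≤ 3 * s.im := by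
    refine (Complex.norm_le_abs_re_add_abs_im s).trans ?_
    rw [abs_of_pos (by linarith), abs_of_pos (by linarith)]; linarith
  have ha : ‖∑' n, zterm n s‖ ≤ ‖s‖ * Q := by
    rw [hQ, ← tsum_mul_left]
    refine tsum_of_norm_bounded (hsm.mul_left _).hasSum fun n => ?_
    refine (zterm_norm n (by linarith) hs1).trans ?_
    gcongr
    · linarith [(Nat.cast_nonneg n : (0:ℝ) ≤ n)]
    · linarith
  have hb : ‖1/(s-1)‖ ≤ 1 := by
    rw [norm_div, norm_one]
    have : 1 ≤ ‖s-1‖ := by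
      refine le_trans ?_ (Complex.abs_im_le_norm _)
      simp only [Complex.sub_im, Complex.one_im, sub_zero]
      exact h3.trans (le_abs_self _)
    exact (div_le_one (by linarith)).2 this
  refine (norm_add_le _ _).trans ?_
  nlinarith

noncomputable def rA (k N : ℕ) (s : ℂ) : ℂ := ∑ n ∈ Finset.Icc 1 N, (rdv k n : ℂ) * (n:ℂ)^(s-1)
noncomputable def rS (k N : ℕ) : ℝ := ∑ n ∈ Finset.Icc 1 N, (rdv k n : ℝ)^2/n
noncomputable def rD (k : ℕ) : ℝ := ∑' n : ℕ, (rdv k n : ℝ) * (n:ℝ)^(-(3/2):ℝ)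

lemma rD_summable (k : ℕ) : Summable (fun n : ℕ => (rdv k n : ℝ) * (n:ℝ)^(-(3/2):ℝ)) :=
  rdv_summable k (by norm_num)

lemma rD_nonneg (k : ℕ) : 0 ≤ rD k := tsum_nonneg fun n => by positivity

lemma rA_sum_half (k N : ℕ) :
    ∑ n ∈ Finset.Icc 1 N, (rdv k n : ℝ) * (n:ℝ)^(1/2:ℝ) ≤ (N:ℝ)^2 * rD k := by
  have h1 := (rD_summable k).sum_le_tsum (Finset.Icc 1 N) (fun n _ => by positivity)
  refine le_trans ?_ (mul_le_mul_of_nonneg_left h1 (by positivity))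
  rw [Finset.mul_sum]
  refine Finset.sum_le_sum fun n hn => ?_
  obtain ⟨h1, h2⟩ := Finset.mem_Icc.1 hn
  have hn0 : (0:ℝ) < n := by exact_mod_cast h1
  have e : (n:ℝ)^(1/2:ℝ) = (n:ℝ)^2 * (n:ℝ)^(-(3/2):ℝ) := by
    rw [← Real.rpow_natCast, ← Real.rpow_add hn0]; norm_num
  rw [e]
  have : (n:ℝ)^2 ≤ (N:ℝ)^2 := by gcongr
  calc _ = (n:ℝ)^2 * ((rdv k n : ℝ) * (n:ℝ)^(-(3/2):ℝ)) := by ring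
    _ ≤ _ := by gcongr

lemma rA_sum_neg_half (k N : ℕ) :
    ∑ n ∈ Finset.Icc 1 N, (rdv k n : ℝ) * (n:ℝ)^(-(1/2):ℝ) ≤ (N:ℝ) * rD k := by
  have h1 := (rD_summable k).sum_le_tsum (Finset.Icc 1 N) (fun n _ => by positivity)
  refine le_trans ?_ (mul_le_mul_of_nonneg_left h1 (by positivity))
  rw [Finset.mul_sum]
  refine Finset.sum_le_sum fun n hn => ?_
  obtain ⟨h1, h2⟩ := Finset.mem_Icc.1 hn
  have hn0 : (0:ℝ) < n := by exact_mod_cast h1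
  have e : (n:ℝ)^(-(1/2):ℝ) = (n:ℝ) * (n:ℝ)^(-(3/2):ℝ) := by
    nth_rewrite 2 [← Real.rpow_one (n:ℝ)]
    rw [← Real.rpow_add hn0]; norm_num
  rw [e]
  have : (n:ℝ) ≤ (N:ℝ) := by exact_mod_cast h2
  calc _ = (n:ℝ) * ((rdv k n : ℝ) * (n:ℝ)^(-(3/2):ℝ)) := by ring
    _ ≤ _ := by gcongr

lemma rA_norm_le (k N : ℕ) {s : ℂ} (hs : s.re ≤ 3/2) : ‖rA k N s‖ ≤ (N:ℝ)^2 * rD k := by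
  refine le_trans (norm_sum_le _ _) (le_trans (Finset.sum_le_sum fun n hn => ?_) (rA_sum_half k N))
  obtain ⟨h1, h2⟩ := Finset.mem_Icc.1 hn
  rw [norm_mul, Complex.norm_natCast, Complex.norm_natCast_cpow_of_pos h1]
  gcongr
  · exact_mod_cast h1
  · simp; linarith

lemma rA_diff (k N : ℕ) : Differentiable ℂ (rA k N) := by
  unfold rA
  refine Differentiable.fun_sum fun n hn => ?_
  have h1 : (n:ℂ) ≠ 0 := by
    have := (Finset.mem_Icc.1 hn).1
    exact_mod_cast (by omega : n ≠ 0)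
  refine Differentiable.const_mul ?_ _
  intro s
  exact DifferentiableAt.const_cpow (by fun_prop) (Or.inl h1)

lemma r_cpow_split {n : ℕ} (hn : 1 ≤ n) (x t : ℝ) :
    (n:ℂ)^((x:ℂ) + Complex.I * t) = (((n:ℝ)^x : ℝ) : ℂ) * Complex.exp (Complex.I * ((t * Real.log n : ℝ):ℂ)) := by
  have h0 : (n:ℂ) ≠ 0 := by exact_mod_cast (by omega : n ≠ 0)
  rw [Complex.cpow_add _ _ h0, Complex.ofReal_cpow (by positivity), Complex.cpow_def_of_ne_zero h0 (Complex.I * t),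
    ← Complex.natCast_log]
  push_cast
  ring_nf

lemma r_osc {l : ℝ} (hl : l ≠ 0) (a b : ℝ) :
    ‖∫ t in a..b, Complex.exp (Complex.I * ((t * l : ℝ):ℂ))‖ ≤ 2 / |l| := by
  have hc : Complex.I * (l:ℂ) ≠ 0 := mul_ne_zero Complex.I_ne_zero (by exact_mod_cast hl)
  have e : ∀ t : ℝ, Complex.exp (Complex.I * ((t * l : ℝ):ℂ)) = Complex.exp (Complex.I * l * t) := by
    intro t; congr 1; push_cast; ring
  simp_rw [e]
  rw [integral_exp_mul_complex hc, norm_div]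
  have : ‖Complex.I * (l:ℂ)‖ = |l| := by simp
  rw [this]
  gcongr
  refine (norm_sub_le _ _).trans ?_
  have e2 : ∀ t : ℝ, ‖Complex.exp (Complex.I * l * t)‖ = 1 := by
    intro t; rw [← e, mul_comm, Complex.norm_exp_ofReal_mul_I]
  rw [e2, e2]; norm_num

lemma r_gap {m n N : ℕ} (hm : 1 ≤ m) (hn : 1 ≤ n) (hN : n ≤ N) (hmn : m ≠ n) :
    1 / (2 * (N:ℝ)) ≤ |Real.log n - Real.log m| := by
  have hm0 : (0:ℝ) < m := by exact_mod_cast hm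
  have hn0 : (0:ℝ) < n := by exact_mod_cast hn
  have hn1 : (1:ℝ) ≤ n := by exact_mod_cast hn
  have hNn : (n:ℝ) ≤ N := by exact_mod_cast hN
  have hN0 : (0:ℝ) < N := by linarith
  rcases lt_or_gt_of_ne hmn with h | h
  · have h1 : (m:ℝ) + 1 ≤ n := by exact_mod_cast h
    have := Real.one_sub_inv_le_log_of_pos (x := (n:ℝ)/m) (by positivity)
    rw [Real.log_div hn0.ne' hm0.ne', inv_div] at this
    refine le_trans ?_ (this.trans (le_abs_self _))
    rw [one_sub_div hn0.ne', div_le_div_iff₀ (by positivity) hn0]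
    nlinarith
  · have h1 : (n:ℝ) + 1 ≤ m := by exact_mod_cast h
    have := Real.one_sub_inv_le_log_of_pos (x := (m:ℝ)/n) (by positivity)
    rw [Real.log_div hm0.ne' hn0.ne', inv_div] at this
    rw [abs_sub_comm]
    refine le_trans ?_ (this.trans (le_abs_self _))
    rw [one_sub_div hm0.ne', div_le_div_iff₀ (by positivity) hm0]
    nlinarith

lemma r_osc2 {m n N : ℕ} (hm : 1 ≤ m) (hn : 1 ≤ n) (hN : n ≤ N) (hmn : m ≠ n) (a b : ℝ) :
    ‖∫ t in a..b, Complex.exp (Complex.I * ((t * (Real.log n - Real.log m) : ℝ):ℂ))‖ ≤ 4 * N := by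
  have hg := r_gap hm hn hN hmn
  have hN0 : (0:ℝ) < N := by exact_mod_cast (by omega : 0 < N)
  have hp : 0 < 1 / (2 * (N:ℝ)) := by positivity
  have hl : Real.log n - Real.log m ≠ 0 := by
    intro h; rw [h, abs_zero] at hg; linarith
  refine (r_osc hl a b).trans ?_
  calc 2 / |Real.log n - Real.log m| ≤ 2 / (1 / (2 * (N:ℝ))) := by gcongr
    _ = 4 * N := by field_simp; norm_num

/-- one row of the right-hand side -/
lemma r_row (k N n : ℕ) (hn : 1 ≤ n) (hN : n ≤ N) (a b : ℝ) :
    ‖(∫ t in a..b, riemannZeta (3/2 + Complex.I * (t:ℝ)) ^ k *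
        ((rdv k n : ℂ) * (n:ℂ)^((3/2 + Complex.I * (t:ℝ)) - 1 : ℂ))) -
        (((b - a) * ((rdv k n : ℝ)^2/n) : ℝ) : ℂ)‖ ≤
      4 * N * rD k * ((rdv k n : ℝ) * (n:ℝ)^(1/2:ℝ)) := by
  set q : ℝ := (rdv k n : ℝ) * (n:ℝ)^(1/2:ℝ) with hq
  have hq0 : 0 ≤ q := by positivity
  have hn0 : (0:ℝ) < n := by exact_mod_cast hn
  set w : ℕ → ℝ := fun m => (rdv k m : ℝ) * (m:ℝ)^(-(3/2):ℝ) with hw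
  have hw0 : ∀ m, 0 ≤ w m := fun m => by positivity
  set F : ℕ → ℝ → ℂ := fun m t => ((w m * q : ℝ):ℂ) *
    Complex.exp (Complex.I * ((t * (Real.log n - Real.log m) : ℝ):ℂ)) with hF
  have hFn : ∀ m t, ‖F m t‖ = w m * q := by
    intro m t
    rw [hF]; simp only
    rw [norm_mul, mul_comm Complex.I, Complex.norm_exp_ofReal_mul_I, mul_one, Complex.norm_real,
      Real.norm_of_nonneg (mul_nonneg (hw0 m) hq0)]
  have hFc : ∀ m, Continuous (F m) := by intro m; rw [hF]; fun_prop
  have hFs : ∀ t : ℝ, HasSum (fun m => F m t) (riemannZeta (3/2 + Complex.I * (t:ℝ)) ^ k *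
        ((rdv k n : ℂ) * (n:ℂ)^((3/2 + Complex.I * (t:ℝ)) - 1 : ℂ))) := by
    intro t
    have h := (rdv_LSeries k (s := 3/2 + Complex.I * t) (by simp; norm_num)).mul_right
      ((rdv k n : ℂ) * (n:ℂ)^((3/2 + Complex.I * (t:ℝ)) - 1 : ℂ))
    refine h.congr_fun ?_ |> id
    intro m
    rw [hF]; simp only
    rcases Nat.eq_zero_or_pos m with rfl | hm
    · simp [hw, rdv_at_zero]
    rw [LSeries.term_of_ne_zero (by omega)]
    have e1 : (n:ℂ)^((3/2 + Complex.I * (t:ℝ)) - 1 : ℂ) = (n:ℂ)^(((1/2:ℝ):ℂ) + Complex.I * t) := by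
      congr 1; push_cast; ring
    have e2 : (rdv k m : ℂ) / (m:ℂ)^(3/2 + Complex.I * (t:ℂ)) =
        (rdv k m : ℂ) * (m:ℂ)^(((-(3/2):ℝ):ℂ) + Complex.I * ((-t:ℝ):ℂ)) := by
      rw [div_eq_mul_inv, ← Complex.cpow_neg]; congr 2; push_cast; ring
    rw [e1, e2, r_cpow_split hm, r_cpow_split hn]
    have e3 : Complex.exp (Complex.I * ((t * (Real.log n - Real.log m) : ℝ):ℂ)) =
        Complex.exp (Complex.I * ((-t * Real.log m : ℝ):ℂ)) * Complex.exp (Complex.I * ((t * Real.log n : ℝ):ℂ)) := by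
      rw [← Complex.exp_add]; congr 1; push_cast; ring
    rw [e3, hw, hq]; push_cast; ring
  have hint : HasSum (fun m => ∫ t in a..b, F m t) (∫ t in a..b, riemannZeta (3/2 + Complex.I * (t:ℝ)) ^ k *
        ((rdv k n : ℂ) * (n:ℂ)^((3/2 + Complex.I * (t:ℝ)) - 1 : ℂ))) := by
    refine intervalIntegral.hasSum_integral_of_dominated_convergence (fun m _ => w m * q)
      (fun m => (hFc m).aestronglyMeasurable) (fun m => Filter.Eventually.of_forall fun t _ => (hFn m t).le)
      (Filter.Eventually.of_forall fun t _ => (rD_summable k).mul_right q) ?_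
      (Filter.Eventually.of_forall fun t _ => hFs t)
    exact intervalIntegrable_const
  have hdiag : HasSum (fun m : ℕ => if m = n then (((b - a) * ((rdv k n : ℝ)^2/n) : ℝ) : ℂ) else 0)
      (((b - a) * ((rdv k n : ℝ)^2/n) : ℝ) : ℂ) := hasSum_ite_eq n _
  have hsub := hint.sub hdiag
  have hB : HasSum (fun m => w m * (q * (4 * N))) (rD k * (q * (4*N))) :=
    (rD_summable k).hasSum.mul_right _
  rw [← hsub.tsum_eq]
  refine (tsum_of_norm_bounded hB fun m => ?_).trans (le_of_eq (by ring))
  have hfac : (∫ t in a..b, F m t) = ((w m * q : ℝ):ℂ) *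
      ∫ t in a..b, Complex.exp (Complex.I * ((t * (Real.log n - Real.log m) : ℝ):ℂ)) := by
    rw [← intervalIntegral.integral_const_mul]
  by_cases hmn : m = n
  · subst hmn
    rw [if_pos rfl, hfac]
    have : w m * q = (rdv k m : ℝ)^2/m := by
      rw [hw, hq]
      have : (m:ℝ)^(-(3/2):ℝ) * (m:ℝ)^(1/2:ℝ) = (m:ℝ)⁻¹ := by
        rw [← Real.rpow_add hn0, ← Real.rpow_neg_one]; norm_num
      calc _ = (rdv k m : ℝ)^2 * ((m:ℝ)^(-(3/2):ℝ) * (m:ℝ)^(1/2:ℝ)) := by ring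
        _ = _ := by rw [this]; rfl
    rw [this]
    have h0 : (((rdv k m : ℝ)^2/m : ℝ):ℂ) * (∫ t in a..b, Complex.exp (Complex.I * ((t * (Real.log m - Real.log m) : ℝ):ℂ))) - (((b - a) * ((rdv k m : ℝ)^2/m) : ℝ) : ℂ) = 0 := by
      simp only [sub_self, mul_zero, Complex.ofReal_zero, Complex.exp_zero, intervalIntegral.integral_const]
      rw [Complex.real_smul]; push_cast; ring
    rw [h0, norm_zero]
    have := hw0 m
    positivity
  · rw [if_neg hmn, sub_zero, hfac, norm_mul, Complex.norm_real, Real.norm_of_nonneg (mul_nonneg (hw0 m) hq0), mul_assoc]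
    rcases Nat.eq_zero_or_pos m with rfl | hm
    · simp [hw, rdv_at_zero]
    · have := r_osc2 hm hn hN hmn a b
      have := hw0 m
      gcongr

lemma zeta_line_cont {x : ℝ} (hx : x ≠ 1) : Continuous (fun t : ℝ => riemannZeta ((x:ℂ) + Complex.I * t)) := by
  rw [continuous_iff_continuousAt]
  intro t
  have : ((x:ℂ) + Complex.I * t) ≠ 1 := by
    intro h; apply hx; have := congrArg Complex.re h; simpa using this
  exact ContinuousAt.comp (f := fun t : ℝ => (x:ℂ) + Complex.I * t) (differentiableAt_riemannZeta this).continuousAt (by fun_prop)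

noncomputable def rP (k N : ℕ) (s : ℂ) : ℂ := riemannZeta s ^ k * rA k N s

lemma rP_line_cont (k N : ℕ) {x : ℝ} (hx : x ≠ 1) : Continuous (fun t : ℝ => rP k N ((x:ℂ) + Complex.I * t)) := by
  unfold rP
  have := zeta_line_cont hx
  have h2 := (rA_diff k N).continuous
  fun_prop

lemma rP_right (k N : ℕ) (a b : ℝ) :
    ‖(∫ t in a..b, rP k N (((3/2:ℝ):ℂ) + Complex.I * t)) - (((b-a) * rS k N : ℝ):ℂ)‖ ≤ 4 * rD k ^ 2 * (N:ℝ)^3 := by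
  have e : (∫ t in a..b, rP k N (((3/2:ℝ):ℂ) + Complex.I * t)) = ∑ n ∈ Finset.Icc 1 N,
      ∫ t in a..b, riemannZeta (3/2 + Complex.I * (t:ℝ)) ^ k *
        ((rdv k n : ℂ) * (n:ℂ)^((3/2 + Complex.I * (t:ℝ)) - 1 : ℂ)) := by
    rw [← intervalIntegral.integral_finsetSum]
    · refine intervalIntegral.integral_congr fun t _ => ?_
      simp only [rP, rA, Finset.mul_sum]; push_cast; rfl
    · intro n hn
      refine Continuous.intervalIntegrable ?_ _ _
      have h1 := zeta_line_cont (x := 3/2) (by norm_num)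
      push_cast at h1
      have hn0 : (n:ℂ) ≠ 0 := by
        have := (Finset.mem_Icc.1 hn).1
        exact_mod_cast (by omega : n ≠ 0)
      refine (h1.pow k).mul (continuous_const.mul ?_)
      exact Continuous.const_cpow (by fun_prop) (Or.inl hn0)
  rw [e, rS, Finset.mul_sum, Complex.ofReal_sum, ← Finset.sum_sub_distrib]
  refine (norm_sum_le _ _).trans ((Finset.sum_le_sum fun n hn => r_row k N n (Finset.mem_Icc.1 hn).1 (Finset.mem_Icc.1 hn).2 a b).trans ?_)
  rw [← Finset.mul_sum]
  have := rA_sum_half k N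
  have h0 := rD_nonneg k
  calc _ ≤ 4 * N * rD k * ((N:ℝ)^2 * rD k) := by gcongr
    _ = _ := by ring

lemma rA_meansq (k N : ℕ) (a b : ℝ) :
    ∫ t in a..b, ‖rA k N (((1/2:ℝ):ℂ) + Complex.I * t)‖^2 ≤ (b-a) * rS k N + 4 * rD k^2 * (N:ℝ)^3 := by
  set w : ℕ → ℝ := fun m => (rdv k m : ℝ) * (m:ℝ)^(-(1/2):ℝ) with hw
  have hw0 : ∀ m, 0 ≤ w m := fun m => by positivity
  have hA : ∀ t : ℝ, rA k N (((1/2:ℝ):ℂ) + Complex.I * t) =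
      ∑ n ∈ Finset.Icc 1 N, (w n : ℂ) * Complex.exp (Complex.I * ((t * Real.log n : ℝ):ℂ)) := by
    intro t
    refine Finset.sum_congr rfl fun n hn => ?_
    rw [show ((1/2:ℝ):ℂ) + Complex.I * t - 1 = ((-(1/2):ℝ):ℂ) + Complex.I * t by push_cast; ring,
      r_cpow_split (Finset.mem_Icc.1 hn).1, hw]
    push_cast; ring
  have hsq : ∀ t : ℝ, ((‖rA k N (((1/2:ℝ):ℂ) + Complex.I * t)‖^2 : ℝ):ℂ) =
      ∑ n ∈ Finset.Icc 1 N, ∑ m ∈ Finset.Icc 1 N, ((w n * w m : ℝ):ℂ) *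
        Complex.exp (Complex.I * ((t * (Real.log n - Real.log m) : ℝ):ℂ)) := by
    intro t
    have : ((‖rA k N (((1/2:ℝ):ℂ) + Complex.I * t)‖^2 : ℝ):ℂ) = rA k N (((1/2:ℝ):ℂ) + Complex.I * t) * (starRingEnd ℂ) (rA k N (((1/2:ℝ):ℂ) + Complex.I * t)) := by
      rw [Complex.mul_conj, Complex.normSq_eq_norm_sq]
    rw [this, hA, map_sum, Finset.sum_mul_sum]
    refine Finset.sum_congr rfl fun n _ => Finset.sum_congr rfl fun m _ => ?_
    rw [map_mul, Complex.conj_ofReal, ← Complex.exp_conj, map_mul, Complex.conj_I, Complex.conj_ofReal]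
    have e3 : Complex.exp (Complex.I * ((t * (Real.log n - Real.log m) : ℝ):ℂ)) =
        Complex.exp (Complex.I * ((t * Real.log n : ℝ):ℂ)) * Complex.exp (-Complex.I * ((t * Real.log m : ℝ):ℂ)) := by
      rw [← Complex.exp_add]; congr 1; push_cast; ring
    rw [e3]; push_cast; ring
  have hint : ((∫ t in a..b, ‖rA k N (((1/2:ℝ):ℂ) + Complex.I * t)‖^2 : ℝ):ℂ) =
      ∑ n ∈ Finset.Icc 1 N, ∑ m ∈ Finset.Icc 1 N, ((w n * w m : ℝ):ℂ) *
        ∫ t in a..b, Complex.exp (Complex.I * ((t * (Real.log n - Real.log m) : ℝ):ℂ)) := by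
    rw [← intervalIntegral.integral_ofReal]
    simp_rw [hsq]
    rw [intervalIntegral.integral_finsetSum]
    · refine Finset.sum_congr rfl fun n _ => ?_
      rw [intervalIntegral.integral_finsetSum]
      · refine Finset.sum_congr rfl fun m _ => ?_
        rw [intervalIntegral.integral_const_mul]
      · intro m _; exact Continuous.intervalIntegrable (by fun_prop) _ _
    · intro n _; exact Continuous.intervalIntegrable (by fun_prop) _ _
  have hkey : ‖((∫ t in a..b, ‖rA k N (((1/2:ℝ):ℂ) + Complex.I * t)‖^2 : ℝ):ℂ) - (((b-a) * rS k N : ℝ):ℂ)‖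
      ≤ 4 * rD k^2 * (N:ℝ)^3 := by
    have hd : (((b-a) * rS k N : ℝ):ℂ) = ∑ n ∈ Finset.Icc 1 N, ∑ m ∈ Finset.Icc 1 N,
        if m = n then (((b-a) * ((rdv k n : ℝ)^2/n) : ℝ):ℂ) else 0 := by
      rw [rS, Finset.mul_sum, Complex.ofReal_sum]
      refine Finset.sum_congr rfl fun n hn => ?_
      rw [Finset.sum_ite_eq' , if_pos hn]
    rw [hint, hd, ← Finset.sum_sub_distrib]
    simp_rw [← Finset.sum_sub_distrib]
    refine (norm_sum_le _ _).trans ?_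
    calc _ ≤ ∑ n ∈ Finset.Icc 1 N, ∑ m ∈ Finset.Icc 1 N, w n * w m * (4 * N) := by
          refine Finset.sum_le_sum fun n hn => (norm_sum_le _ _).trans (Finset.sum_le_sum fun m hm => ?_)
          rw [Finset.mem_Icc] at hn hm
          have hp := mul_nonneg (hw0 n) (hw0 m)
          by_cases hmn : m = n
          · subst hmn
            rw [if_pos rfl]
            have hn0 : (0:ℝ) < m := by exact_mod_cast hn.1
            have : w m * w m = (rdv k m : ℝ)^2/m := by
              have : (m:ℝ)^(-(1/2):ℝ) * (m:ℝ)^(-(1/2):ℝ) = (m:ℝ)⁻¹ := by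
                rw [← Real.rpow_add hn0, ← Real.rpow_neg_one]; norm_num
              calc _ = (rdv k m : ℝ)^2 * ((m:ℝ)^(-(1/2):ℝ) * (m:ℝ)^(-(1/2):ℝ)) := by rw [hw]; ring
                _ = _ := by rw [this]; rfl
            rw [← this]
            have h0 : ((w m * w m : ℝ):ℂ) * (∫ t in a..b, Complex.exp (Complex.I * ((t * (Real.log m - Real.log m) : ℝ):ℂ))) - (((b - a) * (w m * w m) : ℝ) : ℂ) = 0 := by
              simp only [sub_self, mul_zero, Complex.ofReal_zero, Complex.exp_zero, intervalIntegral.integral_const]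
              rw [Complex.real_smul]; push_cast; ring
            rw [h0, norm_zero]
            positivity
          · rw [if_neg hmn, sub_zero, norm_mul, Complex.norm_real, Real.norm_of_nonneg hp]
            have := r_osc2 hm.1 hn.1 hn.2 hmn a b
            gcongr
      _ = (∑ n ∈ Finset.Icc 1 N, w n) * (∑ n ∈ Finset.Icc 1 N, w n) * (4*N) := by
          rw [Finset.sum_mul_sum, Finset.sum_mul]
          simp_rw [Finset.sum_mul]
      _ ≤ ((N:ℝ) * rD k) * ((N:ℝ) * rD k) * (4*N) := by
          have := rA_sum_neg_half k N
          have h0 := rD_nonneg k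
          have h1 : 0 ≤ ∑ n ∈ Finset.Icc 1 N, w n := Finset.sum_nonneg fun n _ => hw0 n
          gcongr
      _ = _ := by ring
  rw [← Complex.ofReal_sub, Complex.norm_real, Real.norm_eq_abs] at hkey
  linarith [(abs_le.1 hkey).2]

lemma r_ker_norm (x y : ℝ) :
    ‖Complex.exp (-Complex.cos ((x + y * Complex.I) - 1))‖ = Real.exp (-(Real.cos (x-1) * Real.cosh y)) := by
  rw [Complex.norm_exp]
  congr 1
  have : ((x:ℂ) + y * Complex.I) - 1 = ((x-1 : ℝ):ℂ) + y * Complex.I := by push_cast; ring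
  rw [this]
  generalize x - 1 = a
  rw [Complex.cos_add_mul_I, ← Complex.ofReal_cos, ← Complex.ofReal_sin, ← Complex.ofReal_cosh,
    ← Complex.ofReal_sinh]
  simp
  exact Or.inl (Complex.cos_ofReal_re a)

lemma r_ker_le {x : ℝ} (hx0 : 0 ≤ x) (hx1 : x ≤ 1) (y : ℝ) :
    ‖Complex.exp (-Complex.cos ((x + y * Complex.I) - 1))‖ ≤ Real.exp (-(Real.cos 1 * Real.cosh y)) := by
  rw [r_ker_norm]
  have : Real.cos 1 ≤ Real.cos (x-1) := by
    rw [← Real.cos_neg (x-1)]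
    exact Real.cos_le_cos_of_nonneg_of_le_pi (by linarith) (by linarith [Real.pi_gt_three]) (by linarith)
  have := Real.cosh_pos y
  gcongr

lemma r_contour (k N : ℕ) (τ H Pb : ℝ) (hH : 0 ≤ H) (hτ : 1 ≤ τ - H)
    (hP : ∀ s : ℂ, 1/2 ≤ s.re → s.re ≤ 3/2 → (s.im = τ - H ∨ s.im = τ + H) → ‖rP k N s‖ ≤ Pb) :
    ‖∫ y in (-H)..H, rP k N (((3/2:ℝ):ℂ) + Complex.I * ((τ + y : ℝ):ℂ)) * (Real.exp (-Real.cosh y) : ℂ)‖ ≤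
      (∫ y in (-H)..H, ‖rP k N (((1/2:ℝ):ℂ) + Complex.I * ((τ + y : ℝ):ℂ))‖ * Real.exp (-(Real.cos 1 * Real.cosh y)))
        + 2 * (Pb * Real.exp (-(Real.cos 1 * Real.cosh H))) := by
  set f : ℂ → ℂ := fun z => rP k N (((1/2:ℝ):ℂ) + Complex.I * τ + z) * Complex.exp (-Complex.cos (z - 1)) with hf
  have hPb0 : 0 ≤ Pb := (norm_nonneg _).trans (hP ⟨1/2, τ - H⟩ (by norm_num) (by norm_num) (Or.inl rfl))
  have hd : DifferentiableOn ℂ f ((Set.uIcc (⟨0,-H⟩:ℂ).re (⟨1,H⟩:ℂ).re) ×ℂ (Set.uIcc (⟨0,-H⟩:ℂ).im (⟨1,H⟩:ℂ).im)) := by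
    intro z hz
    simp only [Complex.mem_reProdIm] at hz
    rw [Set.uIcc_of_le (by linarith : -H ≤ H)] at hz
    have hne : (((1/2:ℝ):ℂ) + Complex.I * τ + z) ≠ 1 := by
      intro h
      have := congrArg Complex.im h
      simp at this
      linarith [hz.2.1]
    have h1 : DifferentiableAt ℂ (fun z => riemannZeta (((1/2:ℝ):ℂ) + Complex.I * τ + z)) z :=
      DifferentiableAt.comp (g := riemannZeta) (f := fun z => ((1/2:ℝ):ℂ) + Complex.I * τ + z) z
        (differentiableAt_riemannZeta hne) (by fun_prop)
    have h2 : DifferentiableAt ℂ (fun z => rA k N (((1/2:ℝ):ℂ) + Complex.I * τ + z)) z :=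
      DifferentiableAt.comp (g := rA k N) (f := fun z => ((1/2:ℝ):ℂ) + Complex.I * τ + z) z
        (rA_diff k N _) (by fun_prop)
    refine DifferentiableAt.differentiableWithinAt ?_
    rw [hf]
    unfold rP
    refine ((h1.pow k).mul h2).mul ?_
    fun_prop
  have hc := Complex.integral_boundary_rect_eq_zero_of_differentiableOn f ⟨0,-H⟩ ⟨1,H⟩ hd
  simp only [smul_eq_mul] at hc
  have hR : (∫ y in (-H)..H, f (((1:ℝ):ℂ) + y * Complex.I)) =
      ∫ y in (-H)..H, rP k N (((3/2:ℝ):ℂ) + Complex.I * ((τ + y : ℝ):ℂ)) * (Real.exp (-Real.cosh y) : ℂ) := by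
    refine intervalIntegral.integral_congr fun y _ => ?_
    simp only [hf]
    congr 1
    · congr 1; push_cast; ring
    · rw [Complex.ofReal_exp]; congr 1
      push_cast
      rw [add_sub_cancel_left, Complex.cos_mul_I]
  have hedge : ∀ e : ℝ, (e = -H ∨ e = H) → ‖∫ x in (0:ℝ)..1, f (x + e * Complex.I)‖ ≤
      Pb * Real.exp (-(Real.cos 1 * Real.cosh H)) := by
    intro e he
    have := intervalIntegral.norm_integral_le_of_norm_le_const (a := (0:ℝ)) (b := 1)
      (f := fun x : ℝ => f (x + e * Complex.I)) (C := Pb * Real.exp (-(Real.cos 1 * Real.cosh H))) ?_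
    · simpa using this
    intro x hx
    rw [Set.uIoc_of_le zero_le_one] at hx
    simp only [hf]
    rw [norm_mul]
    have hk := r_ker_le hx.1.le hx.2 e
    have hce : Real.cosh e = Real.cosh H := by rcases he with rfl | rfl <;> simp
    rw [hce] at hk
    refine mul_le_mul (hP _ ?_ ?_ ?_) hk (norm_nonneg _) hPb0
    · simp; linarith [hx.1]
    · simp; linarith [hx.2]
    · rcases he with rfl | rfl
      · left; simp; ring
      · right; simp
  have hL : ‖∫ y in (-H)..H, f (((0:ℝ):ℂ) + y * Complex.I)‖ ≤
      ∫ y in (-H)..H, ‖rP k N (((1/2:ℝ):ℂ) + Complex.I * ((τ + y : ℝ):ℂ))‖ * Real.exp (-(Real.cos 1 * Real.cosh y)) := by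
    refine intervalIntegral.norm_integral_le_of_norm_le (by linarith) ?_ ?_
    · refine Filter.Eventually.of_forall fun y _ => ?_
      simp only [hf]
      rw [norm_mul]
      refine mul_le_mul (le_of_eq ?_) (r_ker_le le_rfl zero_le_one y) (norm_nonneg _) (norm_nonneg _)
      congr 2; push_cast; ring
    · have := (rP_line_cont k N (x := 1/2) (by norm_num)).norm
      have h2 := this.comp (continuous_const.add continuous_id : Continuous fun y : ℝ => τ + y)
      refine Continuous.intervalIntegrable ?_ _ _
      refine h2.mul ?_
      have := Real.continuous_cosh
      fun_prop
  have h1 := hedge (-H) (Or.inl rfl)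
  have h2 := hedge H (Or.inr rfl)
  rw [← hR]
  set E1 := ∫ x in (0:ℝ)..1, f (x + ((-H:ℝ):ℂ) * Complex.I)
  set E2 := ∫ x in (0:ℝ)..1, f (x + ((H:ℝ):ℂ) * Complex.I)
  set X := ∫ y in (-H)..H, f (((1:ℝ):ℂ) + y * Complex.I)
  set Y := ∫ y in (-H)..H, f (((0:ℝ):ℂ) + y * Complex.I)
  have h3 : X = Y + Complex.I * E1 - Complex.I * E2 := by
    have hI := Complex.I_mul_I
    linear_combination (-Complex.I) * hc + (X - Y) * hI
  rw [h3]
  calc _ ≤ ‖Y‖ + ‖Complex.I * E1‖ + ‖Complex.I * E2‖ := by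
        refine (norm_sub_le _ _).trans ?_
        gcongr
        exact norm_add_le _ _
    _ ≤ _ := by
        rw [norm_mul, norm_mul, Complex.norm_I, one_mul, one_mul]; linarith

lemma r_swap {E : Type*} [NormedAddCommGroup E] [NormedSpace ℝ E] (f : ℝ → ℝ → E) (hf : Continuous f.uncurry) (a b c d : ℝ)
    (hab : a ≤ b) (hcd : c ≤ d) :
    (∫ x in a..b, ∫ y in c..d, f x y) = ∫ y in c..d, ∫ x in a..b, f x y := by
  simp_rw [intervalIntegral.integral_of_le hcd, intervalIntegral.integral_of_le hab]
  refine MeasureTheory.integral_integral_swap ?_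
  rw [MeasureTheory.Measure.prod_restrict]
  have : IntegrableOn f.uncurry (Set.Icc a b ×ˢ Set.Icc c d) (volume.prod volume) :=
    hf.continuousOn.integrableOn_compact (isCompact_Icc.prod isCompact_Icc)
  exact this.mono_set (Set.prod_mono Set.Ioc_subset_Icc_self Set.Ioc_subset_Icc_self)

lemma r_exp_half_le_cosh (y : ℝ) : Real.exp y / 2 ≤ Real.cosh y := by
  rw [Real.cosh_eq]
  have := Real.exp_pos (-y)
  linarith

lemma r_cosh_ge_sq (y : ℝ) : y^2/4 ≤ Real.cosh y := by
  rw [← Real.cosh_abs, ← sq_abs]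
  refine le_trans ?_ (r_exp_half_le_cosh _)
  have h1 := Real.quadratic_le_exp_of_nonneg (abs_nonneg y)
  linarith [abs_nonneg y]

lemma r_ker_int : ∃ Q : ℝ, 0 < Q ∧ ∀ H : ℝ, 0 ≤ H →
    ∫ y in (-H)..H, Real.exp (-(Real.cos 1 * Real.cosh y)) ≤ Q := by
  have hc := Real.cos_one_pos
  have hi := integrable_exp_neg_mul_sq (b := Real.cos 1 / 4) (by positivity)
  have hI0 : 0 ≤ ∫ y : ℝ, Real.exp (-(Real.cos 1/4) * y^2) := integral_nonneg fun y => (Real.exp_pos _).le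
  refine ⟨1 + ∫ y : ℝ, Real.exp (-(Real.cos 1/4) * y^2), by linarith, fun H hH => ?_⟩
  have h1 : ∫ y in (-H)..H, Real.exp (-(Real.cos 1 * Real.cosh y)) ≤
      ∫ y in (-H)..H, Real.exp (-(Real.cos 1/4) * y^2) := by
    refine intervalIntegral.integral_mono_on (by linarith) ?_ ?_ ?_
    · have := Real.continuous_cosh
      exact Continuous.intervalIntegrable (by fun_prop) _ _
    · exact Continuous.intervalIntegrable (by fun_prop) _ _
    · intro y _
      have := r_cosh_ge_sq y
      rw [Real.exp_le_exp]
      nlinarith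
  refine h1.trans ?_
  rw [intervalIntegral.integral_of_le (by linarith)]
  have := setIntegral_le_integral hi (s := Set.Ioc (-H) H) (Filter.Eventually.of_forall fun y => (Real.exp_pos _).le)
  linarith

lemma r_ker_low : ∃ κ : ℝ, 0 < κ ∧ ∀ H : ℝ, 1 ≤ H →
    κ ≤ ∫ y in (-H)..H, Real.exp (-Real.cosh y) := by
  have hcont := Real.continuous_cosh
  refine ⟨∫ y in (-1:ℝ)..1, Real.exp (-Real.cosh y), ?_, fun H hH => ?_⟩
  · refine intervalIntegral.intervalIntegral_pos_of_pos ?_ (fun y => Real.exp_pos _) (by norm_num)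
    exact Continuous.intervalIntegrable (by fun_prop) _ _
  · refine intervalIntegral.integral_mono_interval (by linarith) (by norm_num) hH
      (Filter.Eventually.of_forall fun y => (Real.exp_pos _).le) ?_
    exact Continuous.intervalIntegrable (by fun_prop) _ _

lemma r_cont_param {E : Type*} [NormedAddCommGroup E] [NormedSpace ℝ E] (f : ℝ → ℝ → E)
    (hf : Continuous f.uncurry) (a b : ℝ) : Continuous fun y => ∫ x in a..b, f x y := by
  have h : Continuous (Function.uncurry fun y x => f x y) := by
    have := hf.comp (continuous_snd.prodMk continuous_fst : Continuous fun p : ℝ × ℝ => (p.2, p.1))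
    exact this
  exact intervalIntegral.continuous_parametric_intervalIntegral_of_continuous' h a b

lemma r_shift_mul (g : ℝ → ℂ) (w : ℂ) (a b y : ℝ) :
    (∫ x in a..b, g (x + y) * w) = (∫ t in (a+y)..(b+y), g t) * w := by
  rw [intervalIntegral.integral_mul_const, intervalIntegral.integral_comp_add_right]

lemma r_avg_up (g K : ℝ → ℝ) (hg : Continuous g) (hK : Continuous K) (hg0 : ∀ t, 0 ≤ g t)
    (hK0 : ∀ t, 0 ≤ K t) (T H Q : ℝ) (hH : 0 < H) (hQ : ∫ y in (-H)..H, K y ≤ Q) :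
    (∫ τ in (T-H)..(T+H), ∫ y in (-H)..H, g (τ + y) * K y) ≤
      Q * (∫ t in (T-2*H)..(T+2*H), g t) := by
  set X := ∫ t in (T-2*H)..(T+2*H), g t with hX
  have hX0 : 0 ≤ X := intervalIntegral.integral_nonneg (by linarith) fun t _ => hg0 t
  have hc : Continuous (Function.uncurry fun τ y => g (τ + y) * K y) := by
    simp only [Function.uncurry_def]
    fun_prop
  rw [r_swap (fun τ y => g (τ + y) * K y) hc _ _ _ _ (by linarith) (by linarith)]
  refine le_trans ?_ (mul_le_mul_of_nonneg_right hQ hX0)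
  rw [← intervalIntegral.integral_mul_const]
  refine intervalIntegral.integral_mono_on (by linarith) ?_ ?_ ?_
  · exact (r_cont_param (fun τ y => g (τ + y) * K y) hc _ _).intervalIntegrable _ _
  · exact (hK.mul continuous_const).intervalIntegrable _ _
  · intro y hy
    rw [intervalIntegral.integral_mul_const, mul_comm]
    refine mul_le_mul_of_nonneg_left ?_ (hK0 y)
    rw [intervalIntegral.integral_comp_add_right]
    exact intervalIntegral.integral_mono_interval (by linarith [hy.1]) (by linarith) (by linarith [hy.2])
        (Filter.Eventually.of_forall fun t => hg0 t) (hg.intervalIntegrable _ _)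

set_option maxHeartbeats 1600000 in
/-- the averaged inequality -/
lemma r_average (k N : ℕ) (T H Pb κ Q : ℝ) (hH : 0 < H) (hT : 1 ≤ T - 2*H)
    (hP : ∀ s : ℂ, 1/2 ≤ s.re → s.re ≤ 3/2 → T - 2*H ≤ s.im → s.im ≤ T + 2*H → ‖rP k N s‖ ≤ Pb)
    (hκ0 : 0 ≤ κ) (hκ : κ ≤ ∫ y in (-H)..H, Real.exp (-Real.cosh y))
    (hQ : ∫ y in (-H)..H, Real.exp (-(Real.cos 1 * Real.cosh y)) ≤ Q)
    (hpos : 4 * rD k ^ 2 * (N:ℝ)^3 ≤ 2 * H * rS k N) :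
    κ * (2 * H * rS k N - 4 * rD k ^ 2 * (N:ℝ)^3) ≤
      Q * (∫ t in (T-2*H)..(T+2*H), ‖rP k N (((1/2:ℝ):ℂ) + Complex.I * t)‖) +
        2 * H * (2 * (Pb * Real.exp (-(Real.cos 1 * Real.cosh H)))) := by
  have hcosh := Real.continuous_cosh
  have hcR := rP_line_cont k N (x := 3/2) (by norm_num)
  have hcL := (rP_line_cont k N (x := 1/2) (by norm_num)).norm
  set E := 2 * (Pb * Real.exp (-(Real.cos 1 * Real.cosh H))) with hE
  set fR : ℝ → ℝ → ℂ := fun τ y => rP k N (((3/2:ℝ):ℂ) + Complex.I * ((τ + y : ℝ):ℂ)) * (Real.exp (-Real.cosh y) : ℂ) with hfR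
  set fL : ℝ → ℝ → ℝ := fun τ y => ‖rP k N (((1/2:ℝ):ℂ) + Complex.I * ((τ + y : ℝ):ℂ))‖ * Real.exp (-(Real.cos 1 * Real.cosh y)) with hfL
  have hsumc : Continuous fun p : ℝ × ℝ => p.1 + p.2 := by fun_prop
  have hfRc : Continuous fR.uncurry := by
    have h1 := hcR.comp hsumc
    refine Continuous.mul h1 ?_
    fun_prop
  have hfLc : Continuous fL.uncurry := by
    have h1 := hcL.comp hsumc
    refine Continuous.mul h1 ?_
    fun_prop
  have hRc : Continuous fun τ => ∫ y in (-H)..H, fR τ y :=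
    intervalIntegral.continuous_parametric_intervalIntegral_of_continuous' hfRc _ _
  have hLc : Continuous fun τ => ∫ y in (-H)..H, fL τ y :=
    intervalIntegral.continuous_parametric_intervalIntegral_of_continuous' hfLc _ _
  set W := ∫ τ in (T-H)..(T+H), ∫ y in (-H)..H, fR τ y with hW
  -- upper bound
  have hup : ‖W‖ ≤ (∫ τ in (T-H)..(T+H), ∫ y in (-H)..H, fL τ y) + 2 * H * E := by
    have h1 : ‖W‖ ≤ ∫ τ in (T-H)..(T+H), ((∫ y in (-H)..H, fL τ y) + E) := by
      refine intervalIntegral.norm_integral_le_of_norm_le (by linarith) ?_ ?_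
      · refine Filter.Eventually.of_forall fun τ hτ => ?_
        refine r_contour k N τ H Pb hH.le (by linarith [hτ.1]) ?_
        rintro s h1 h2 (h3 | h3)
        · exact hP s h1 h2 (by linarith [hτ.1]) (by linarith [hτ.2])
        · exact hP s h1 h2 (by linarith [hτ.1]) (by linarith [hτ.2])
      · exact Continuous.intervalIntegrable (by fun_prop) _ _
    rw [intervalIntegral.integral_add (hLc.intervalIntegrable _ _) intervalIntegrable_const,
      intervalIntegral.integral_const, smul_eq_mul] at h1
    linarith
  have hup2 : (∫ τ in (T-H)..(T+H), ∫ y in (-H)..H, fL τ y) ≤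
      Q * (∫ t in (T-2*H)..(T+2*H), ‖rP k N (((1/2:ℝ):ℂ) + Complex.I * t)‖) := by
    exact r_avg_up _ (fun y => Real.exp (-(Real.cos 1 * Real.cosh y))) hcL (by fun_prop)
      (fun t => norm_nonneg _) (fun t => (Real.exp_pos _).le) T H Q hH hQ
  -- lower bound
  have hlow : κ * (2 * H * rS k N - 4 * rD k ^ 2 * (N:ℝ)^3) ≤ ‖W‖ := by
    set κ' := ∫ y in (-H)..H, Real.exp (-Real.cosh y) with hκ'
    have hW2 : W = ∫ y in (-H)..H, (∫ t in (T-H+y)..(T+H+y), rP k N (((3/2:ℝ):ℂ) + Complex.I * t)) * (Real.exp (-Real.cosh y) : ℂ) := by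
      rw [hW, r_swap fR hfRc _ _ _ _ (by linarith) (by linarith)]
      refine intervalIntegral.integral_congr fun y _ => ?_
      exact r_shift_mul (fun t : ℝ => rP k N (((3/2:ℝ):ℂ) + Complex.I * (t:ℂ))) _ _ _ y
    have hWc : Continuous fun y => (∫ t in (T-H+y)..(T+H+y), rP k N (((3/2:ℝ):ℂ) + Complex.I * t)) * (Real.exp (-Real.cosh y) : ℂ) := by
      have := r_cont_param fR hfRc (T-H) (T+H)
      refine this.congr fun y => ?_
      exact r_shift_mul (fun t : ℝ => rP k N (((3/2:ℝ):ℂ) + Complex.I * (t:ℂ))) _ _ _ y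
    have hdiff : ‖W - ((κ' * (2 * H * rS k N) : ℝ):ℂ)‖ ≤ κ' * (4 * rD k ^ 2 * (N:ℝ)^3) := by
      have e1 : ((κ' * (2 * H * rS k N) : ℝ):ℂ) = ∫ y in (-H)..H, ((2 * H * rS k N : ℝ):ℂ) * (Real.exp (-Real.cosh y) : ℂ) := by
        rw [intervalIntegral.integral_const_mul, intervalIntegral.integral_ofReal, ← hκ']; push_cast; ring
      rw [e1, hW2, ← intervalIntegral.integral_sub (hWc.intervalIntegrable _ _)
        (Continuous.intervalIntegrable (by fun_prop) _ _), hκ', ← intervalIntegral.integral_mul_const]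
      refine intervalIntegral.norm_integral_le_of_norm_le (by linarith) ?_ ?_
      · refine Filter.Eventually.of_forall fun y _ => ?_
        rw [← sub_mul, norm_mul, Complex.norm_real, Real.norm_of_nonneg (Real.exp_pos _).le, mul_comm]
        gcongr
        have := rP_right k N (T-H+y) (T+H+y)
        rwa [show T + H + y - (T - H + y) = 2 * H by ring] at this
      · exact Continuous.intervalIntegrable (by fun_prop) _ _
    have h2 : ‖((κ' * (2 * H * rS k N) : ℝ):ℂ)‖ ≤ ‖W‖ + ‖W - ((κ' * (2 * H * rS k N) : ℝ):ℂ)‖ := by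
      have := norm_sub_norm_le ((κ' * (2 * H * rS k N) : ℝ):ℂ) W
      rw [norm_sub_rev] at this; linarith
    rw [Complex.norm_real, Real.norm_eq_abs] at h2
    have h3 := le_abs_self (κ' * (2 * H * rS k N))
    have h4 : κ * (2 * H * rS k N - 4 * rD k ^ 2 * (N:ℝ)^3) ≤ κ' * (2 * H * rS k N - 4 * rD k ^ 2 * (N:ℝ)^3) :=
      mul_le_mul_of_nonneg_right hκ (by linarith)
    linarith
  linarith

lemma rS_ge_one (k N : ℕ) (hN : 1 ≤ N) : 1 ≤ rS k N := by
  have := Finset.single_le_sum (f := fun n : ℕ => (rdv k n : ℝ)^2/n) (s := Finset.Icc 1 N)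
    (fun n _ => by positivity) (Finset.mem_Icc.2 ⟨le_rfl, hN⟩)
  simpa [rS, rdv_one] using this

/-- the core inequality -/
lemma r_core (k N : ℕ) (T G Pb κ Q : ℝ) (hG : 4 ≤ G) (hT : 1 ≤ T - G/2) (hN : 1 ≤ N)
    (hP : ∀ s : ℂ, 1/2 ≤ s.re → s.re ≤ 3/2 → T - G/2 ≤ s.im → s.im ≤ T + G/2 → ‖rP k N s‖ ≤ Pb)
    (hκ0 : 0 < κ) (hκ : ∀ H : ℝ, 1 ≤ H → κ ≤ ∫ y in (-H)..H, Real.exp (-Real.cosh y))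
    (hQ0 : 0 < Q)
    (hQ : ∀ H : ℝ, 0 ≤ H → ∫ y in (-H)..H, Real.exp (-(Real.cos 1 * Real.cosh y)) ≤ Q)
    (hsm : 4 * rD k ^ 2 * (N:ℝ)^3 ≤ G/4)
    (hE : Pb * Real.exp (-(Real.cos 1 * Real.cosh (G/4))) ≤ κ/8) :
    κ^2/(144*Q^2) * G * rS k N ≤
      ∫ t in (T-G)..(T+G), ‖riemannZeta (1 / 2 + Complex.I * (t : ℂ))‖ ^ (2 * k) := by
  have hS := rS_ge_one k N hN
  have hHS : G/4 ≤ G/4 * rS k N := by nlinarith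
  have h := r_average k N T (G/4) Pb κ Q (by linarith) (by linarith)
    (fun s h1 h2 h3 h4 => hP s h1 h2 (by linarith) (by linarith)) hκ0.le (hκ _ (by linarith))
    (hQ _ (by linarith)) (by linarith)
  set X := ∫ t in (T-2*(G/4))..(T+2*(G/4)), ‖rP k N (((1/2:ℝ):ℂ) + Complex.I * t)‖ with hX
  set I := ∫ t in (T-G)..(T+G), ‖riemannZeta (1 / 2 + Complex.I * (t : ℂ))‖ ^ (2 * k) with hI
  set l := 18*Q/κ with hl
  have hl0 : 0 < l := by positivity
  have hz := zeta_line_cont (x := 1/2) (by norm_num)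
  have hA : Continuous fun t : ℝ => rA k N (((1/2:ℝ):ℂ) + Complex.I * t) :=
    (rA_diff k N).continuous.comp (by fun_prop)
  have hcP := (rP_line_cont k N (x := 1/2) (by norm_num)).norm
  have hI' : I = ∫ t in (T-G)..(T+G), ‖riemannZeta (((1/2:ℝ):ℂ) + Complex.I * (t : ℂ))‖ ^ (2 * k) := by
    rw [hI]; push_cast; rfl
  have hXle : X ≤ l/2 * I + 1/(2*l) * (9 * (G/4) * rS k N) := by
    have h1 : X ≤ ∫ t in (T-G)..(T+G), ‖rP k N (((1/2:ℝ):ℂ) + Complex.I * t)‖ :=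
      intervalIntegral.integral_mono_interval (by linarith) (by linarith) (by linarith)
        (Filter.Eventually.of_forall fun t => norm_nonneg _) (hcP.intervalIntegrable _ _)
    have h2 : (∫ t in (T-G)..(T+G), ‖rP k N (((1/2:ℝ):ℂ) + Complex.I * t)‖) ≤
        ∫ t in (T-G)..(T+G), (l/2 * ‖riemannZeta (((1/2:ℝ):ℂ) + Complex.I * (t : ℂ))‖ ^ (2 * k) +
          1/(2*l) * ‖rA k N (((1/2:ℝ):ℂ) + Complex.I * t)‖^2) := by
      refine intervalIntegral.integral_mono_on (by linarith) (hcP.intervalIntegrable _ _)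
        (Continuous.intervalIntegrable (by fun_prop) _ _) ?_
      intro t _
      rw [rP, norm_mul, norm_pow, mul_comm 2 k, pow_mul]
      set u := ‖riemannZeta (((1/2:ℝ):ℂ) + Complex.I * (t : ℂ))‖ ^ k
      set v := ‖rA k N (((1/2:ℝ):ℂ) + Complex.I * t)‖
      have : l/2 * u^2 + 1/(2*l) * v^2 - u*v = 1/(2*l) * (l*u - v)^2 := by field_simp; ring
      have : 0 ≤ 1/(2*l) * (l*u - v)^2 := by positivity
      linarith
    rw [intervalIntegral.integral_add (Continuous.intervalIntegrable (by fun_prop) _ _)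
      (Continuous.intervalIntegrable (by fun_prop) _ _), intervalIntegral.integral_const_mul,
      intervalIntegral.integral_const_mul, ← hI'] at h2
    have h3 := rA_meansq k N (T-G) (T+G)
    have h4 : (∫ t in (T-G)..(T+G), ‖rA k N (((1/2:ℝ):ℂ) + Complex.I * t)‖^2) ≤ 9 * (G/4) * rS k N := by
      linarith
    have h5 := mul_le_mul_of_nonneg_left h4 (by positivity : 0 ≤ 1/(2*l))
    linarith
  set V := G/4 * rS k N with hV
  have hV0 : 0 ≤ V := by linarith
  have a1 : κ * V ≤ Q * X + κ * V / 2 := by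
    have b1 : κ * V ≤ κ * (2 * (G/4) * rS k N - 4 * rD k ^ 2 * (N:ℝ)^3) := by
      refine mul_le_mul_of_nonneg_left ?_ hκ0.le
      linarith
    have b2 : 2 * (G/4) * (2 * (Pb * Real.exp (-(Real.cos 1 * Real.cosh (G/4))))) ≤ κ * V/2 := by
      have c1 : 2 * (G/4) * (2 * (Pb * Real.exp (-(Real.cos 1 * Real.cosh (G/4))))) ≤ 2 * (G/4) * (2 * (κ/8)) := by
        gcongr
      have c2 : κ * (G/4) ≤ κ * V := mul_le_mul_of_nonneg_left hHS hκ0.le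
      linarith
    linarith
  have a2 : Q * X ≤ 9*Q^2/κ * I + κ/4 * V := by
    have := mul_le_mul_of_nonneg_left hXle hQ0.le
    refine this.trans (le_of_eq ?_)
    rw [hl, hV]; field_simp; ring
  have a3 : κ/4 * V ≤ 9*Q^2/κ * I := by linarith
  have a4 : κ^2/(36*Q^2) * V ≤ I := by
    have := mul_le_mul_of_nonneg_left a3 (by positivity : 0 ≤ κ/(9*Q^2))
    calc _ = κ/(9*Q^2) * (κ/4 * V) := by field_simp; ring
      _ ≤ _ := this
      _ = I := by field_simp
  refine le_trans (le_of_eq ?_) a4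
  rw [hV]; field_simp; ring

lemma r_choose_M (m : ℕ) (hm : 1 ≤ m) (G : ℝ) (hG : 1 ≤ G) :
    ∃ M : ℕ, 1 ≤ M ∧ (M:ℝ)^m ≤ G ∧ Real.log G / m ≤ Real.log (M+1) := by
  have hm0 : (0:ℝ) < m := by exact_mod_cast hm
  set x := G^((1:ℝ)/m) with hx
  have hx0 : 0 ≤ x := by positivity
  have hx1 : 1 ≤ x := Real.one_le_rpow hG (by positivity)
  have hxm : x^m = G := by
    rw [hx, ← Real.rpow_natCast, ← Real.rpow_mul (by linarith), one_div_mul_cancel hm0.ne', Real.rpow_one]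
  refine ⟨⌊x⌋₊, ?_, ?_, ?_⟩
  · exact Nat.le_floor (by simpa using hx1)
  · rw [← hxm]
    exact pow_le_pow_left₀ (by positivity) (Nat.floor_le hx0) m
  · have h1 : Real.log x ≤ Real.log (⌊x⌋₊ + 1) :=
      Real.log_le_log (by linarith) (Nat.lt_floor_add_one x).le
    refine le_trans (le_of_eq ?_) h1
    rw [hx, Real.log_rpow (by linarith)]; ring

lemma r_decay (k : ℕ) (B D κ T G : ℝ) (hD : 0 ≤ D) (hB : 1 ≤ B) (hκ : 0 < κ) (hT : 1 < T)
    (h1 : Real.exp (2*(k+2)/Real.cos 1) ≤ T) (h2 : 8*((2*B)^k * D)/κ ≤ T)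
    (hG : 8 * Real.log (Real.log T) ≤ G) :
    (B * (2*T))^k * (T * D) * Real.exp (-(Real.cos 1 * Real.cosh (G/4))) ≤ κ/8 := by
  have hc := Real.cos_one_pos
  have hT0 : 0 < T := by linarith
  set L := Real.log T with hL
  have hL0 : 0 < L := Real.log_pos hT
  have hTL : T = Real.exp L := (Real.exp_log hT0).symm
  have h3 : 2*(k+2)/Real.cos 1 ≤ L := by
    rw [hL, Real.le_log_iff_exp_le hT0]; exact h1
  have h4 : L^2/2 ≤ Real.cosh (G/4) := by
    refine le_trans ?_ (r_exp_half_le_cosh _)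
    have : L^2 ≤ Real.exp (G/4) := by
      rw [← Real.exp_log (by positivity : 0 < L^2), Real.exp_le_exp, Real.log_pow]
      push_cast; linarith
    linarith
  have h5 : Real.exp (-(Real.cos 1 * Real.cosh (G/4))) ≤ Real.exp (-((k+2:ℕ) * L)) := by
    rw [Real.exp_le_exp, neg_le_neg_iff]
    have h6 : 2*(k+2) ≤ L * Real.cos 1 := by rwa [div_le_iff₀ hc] at h3
    have h7 := mul_le_mul_of_nonneg_left h4 hc.le
    push_cast
    nlinarith
  have h8 : Real.exp (-((k+2:ℕ) * L)) = (T^(k+2))⁻¹ := by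
    rw [Real.exp_neg, Real.exp_nat_mul, ← hTL]
  rw [h8] at h5
  calc _ ≤ (B * (2*T))^k * (T * D) * (T^(k+2))⁻¹ := by gcongr
    _ = (2*B)^k * D / T := by
        rw [show B * (2*T) = (2*B)*T by ring, mul_pow]; field_simp; ring
    _ ≤ κ/8 := by
        rw [div_le_iff₀ hκ] at h2
        rw [div_le_iff₀ hT0]; linarith

lemma r_small (u G : ℝ) (N : ℕ) (hu : 0 ≤ u) (hG : 0 ≤ G) (hN : (N:ℝ)^4 ≤ G) (h : u^4 ≤ G) :
    u * (N:ℝ)^3 ≤ G := by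
  refine le_of_pow_le_pow_left₀ (n := 4) (by norm_num) hG ?_
  calc (u * (N:ℝ)^3)^4 = u^4 * ((N:ℝ)^4)^3 := by ring
    _ ≤ G * G^3 := by gcongr
    _ = G^4 := by ring

/-- Ramachandra's lower bound: for every `k ∈ ℕ` there are `c_k, C_k > 0` with
`∫_{T-G}^{T+G} |ζ(1/2+it)|^{2k} dt ≥ c_k G (log G)^{k²}` for all large `T` and
`C_k log log T ≤ G ≤ T`. -/
theorem ramachandra_lower_bound (k : ℕ) (hk : 0 < k) :
    ∃ c C : ℝ, 0 < c ∧ 0 < C ∧ ∃ T₀ : ℝ, ∀ T : ℝ, T₀ ≤ T → ∀ G : ℝ,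
      C * Real.log (Real.log T) ≤ G → G ≤ T →
        c * G * Real.log G ^ (k ^ 2) ≤
          ∫ t in (T - G)..(T + G), ‖riemannZeta (1 / 2 + Complex.I * (t : ℂ))‖ ^ (2 * k) := by
  obtain ⟨z, hz0, hz⟩ := rdv_lower k
  obtain ⟨B, hB1, hB⟩ := zeta_growth
  obtain ⟨Q, hQ0, hQ⟩ := r_ker_int
  obtain ⟨κ, hκ0, hκ⟩ := r_ker_low
  have hD0 := rD_nonneg k
  have hK : 1 ≤ k^2 := Nat.one_le_pow _ _ hk
  have hm : 1 ≤ 4 * k^2 := by omega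
  set m := 4 * k^2 with hmdef
  have hm0 : (0:ℝ) < m := by exact_mod_cast hm
  set G0 := max 4 ((16 * rD k^2)^4) with hG0
  refine ⟨κ^2/(144*Q^2) * (z / (m:ℝ)^(k^2)), 8, by positivity, by norm_num,
    max (max 2 (Real.exp (Real.exp (G0/8)))) (max (Real.exp (2*(k+2)/Real.cos 1)) (8*((2*B)^k * rD k)/κ)),
    fun T hT G hG hGT => ?_⟩
  simp only [max_le_iff] at hT
  obtain ⟨⟨hT2, hTe⟩, hTc, hTd⟩ := hT
  have hGG0 : G0 ≤ G := by
    refine le_trans ?_ hG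
    have h1 : Real.exp (G0/8) ≤ Real.log T := (Real.le_log_iff_exp_le (by linarith)).2 hTe
    have h2 : G0/8 ≤ Real.log (Real.log T) :=
      (Real.le_log_iff_exp_le ((Real.exp_pos _).trans_le h1)).2 h1
    linarith
  have hG4 : 4 ≤ G := (le_max_left _ _).trans hGG0
  have hGD : (16 * rD k^2)^4 ≤ G := (le_max_right _ _).trans hGG0
  obtain ⟨M, hM1, hMG, hML⟩ := r_choose_M m hm G (by linarith)
  have hN1 : 1 ≤ M^(k^2) := Nat.one_le_pow _ _ hM1
  have hN4 : ((M^(k^2) : ℕ):ℝ)^4 ≤ G := by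
    push_cast
    rw [← pow_mul, mul_comm]; exact hMG
  have hN2 : ((M^(k^2) : ℕ):ℝ)^2 ≤ T := by
    have h1 : (1:ℝ) ≤ ((M^(k^2) : ℕ):ℝ) := by exact_mod_cast hN1
    have := pow_le_pow_right₀ h1 (by norm_num : 2 ≤ 4)
    linarith
  have hsm := r_small (16 * rD k^2) G (M^(k^2)) (by positivity) (by linarith) hN4 hGD
  have hSz := hz M
  change _ ≤ rS k (M^(k^2)) at hSz
  have core := r_core k (M^(k^2)) T G ((B * (2*T))^k * (T * rD k)) κ Q hG4 (by linarith) hN1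
    (by
      intro s h1 h2 h3 h4
      rw [rP, norm_mul, norm_pow]
      have hzs : ‖riemannZeta s‖ ≤ B * (2*T) := by
        refine (hB s h1 (by linarith) (by linarith)).trans ?_
        gcongr; linarith
      have hAs : ‖rA k (M^(k^2)) s‖ ≤ T * rD k :=
        (rA_norm_le k _ h2).trans (mul_le_mul_of_nonneg_right hN2 hD0)
      gcongr)
    hκ0 hκ hQ0 hQ (by linarith)
    (r_decay k B (rD k) κ T G hD0 hB1 hκ0 (by linarith) hTc hTd hG)
  refine le_trans ?_ core
  have hlog : 0 ≤ Real.log G := Real.log_nonneg (by linarith)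
  have hfin : z / (m:ℝ)^(k^2) * Real.log G ^ (k^2) ≤ rS k (M^(k^2)) := by
    refine le_trans ?_ hSz
    have h1 : (Real.log G / m)^(k^2) ≤ Real.log (M+1) ^ (k^2) :=
      pow_le_pow_left₀ (by positivity) hML _
    calc _ = z * (Real.log G / m)^(k^2) := by rw [div_pow]; ring
      _ ≤ _ := mul_le_mul_of_nonneg_left h1 hz0.le
  have hG0' : 0 ≤ κ^2/(144*Q^2) * G := mul_nonneg (by positivity) (by linarith)
  calc _ = κ^2/(144*Q^2) * G * (z / (m:ℝ)^(k^2) * Real.log G ^ (k^2)) := by ring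
    _ ≤ _ := mul_le_mul_of_nonneg_left hfin hG0'
end

section
/- For every natural number k there is a constant C_k > 0 such that for all t ≥ 2, |ζ(1/2 + it)|^{k} ≤ C_k ( log t · ∫_{t−1/3}^{t+1/3} |ζ(1/2 + iu)|^{k} du + 1 ). -/
open Real MeasureTheory

noncomputable def zphi (t : ℝ) : ℂ := Set.indicator (Set.Ioi 1) (fun t : ℝ => ((Int.fract t : ℝ) : ℂ)) t

lemma zphi_norm (t : ℝ) : ‖zphi t‖ ≤ 1 := by
  unfold zphi
  refine (norm_indicator_le_norm_self _ _).trans ?_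
  rw [Complex.norm_real, Real.norm_of_nonneg (Int.fract_nonneg _)]
  exact (Int.fract_lt_one _).le

lemma zphi_meas : Measurable zphi :=
  (Complex.measurable_ofReal.comp measurable_fract).indicator measurableSet_Ioi

lemma zphi_locint : LocallyIntegrableOn zphi (Set.Ioi 0) := by
  apply LocallyIntegrable.locallyIntegrableOn
  refine (locallyIntegrable_const (1:ℂ)).mono zphi_meas.aestronglyMeasurable ?_
  filter_upwards with x
  simpa using zphi_norm x

lemma zphi_top : zphi =O[Filter.atTop] (fun x : ℝ => x ^ (-(0:ℝ))) := by
  apply Asymptotics.IsBigO.of_bound 1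
  filter_upwards with x
  simpa using zphi_norm x

lemma zphi_bot (b : ℝ) : zphi =O[nhdsWithin 0 (Set.Ioi 0)] (fun x : ℝ => x ^ (-b)) := by
  apply Asymptotics.IsBigO.of_bound 1
  filter_upwards [mem_nhdsWithin_of_mem_nhds (Iio_mem_nhds (zero_lt_one (α := ℝ)))] with x hx
  have : zphi x = 0 := by
    unfold zphi
    apply Set.indicator_of_notMem
    simpa using le_of_lt hx
  rw [this]
  simp
  

lemma mellin_zphi_diff {s : ℂ} (hs : s.re < 0) : DifferentiableAt ℂ (mellin zphi) s :=
  mellin_differentiableAt_of_isBigO_rpow zphi_locint zphi_top hs (zphi_bot (s.re - 1)) (by linarith)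

lemma mellin_zphi_conv {s : ℂ} (hs : s.re < 0) : MellinConvergent zphi s :=
  mellinConvergent_of_isBigO_rpow zphi_locint zphi_top hs (zphi_bot (s.re - 1)) (by linarith)

lemma mellin_zphi_eq (s : ℂ) : mellin zphi s =
    ∫ t in Set.Ioi (1:ℝ), ((Int.fract t : ℝ) : ℂ) * (t:ℂ) ^ (s - 1) := by
  unfold mellin
  have : ∀ t : ℝ, (t:ℂ) ^ (s-1) • zphi t = Set.indicator (Set.Ioi 1)
      (fun t : ℝ => ((Int.fract t : ℝ) : ℂ) * (t:ℂ) ^ (s - 1)) t := by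
    intro t
    unfold zphi
    by_cases h : t ∈ Set.Ioi (1:ℝ)
    · simp only [Set.indicator_of_mem h, smul_eq_mul, mul_comm]
    · simp only [Set.indicator_of_notMem h, smul_zero]
  simp_rw [this]
  rw [setIntegral_indicator measurableSet_Ioi, Set.inter_eq_right.mpr]
  exact Set.Ioi_subset_Ioi zero_le_one

lemma zphi_integrableOn {s : ℂ} (hs : s.re < 0) :
    IntegrableOn (fun t : ℝ => ((Int.fract t : ℝ) : ℂ) * (t:ℂ) ^ (s - 1)) (Set.Ioi 1) := by
  have h := (mellin_zphi_conv hs).mono_set (Set.Ioi_subset_Ioi zero_le_one : Set.Ioi (1:ℝ) ⊆ Set.Ioi 0)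
  refine h.congr_fun (fun t ht => ?_) measurableSet_Ioi
  simp only [zphi, Set.indicator_of_mem ht, smul_eq_mul, mul_comm]

lemma mellin_zphi_bound {s : ℂ} (hs : s.re < 0) : ‖mellin zphi s‖ ≤ 1 / (-s.re) := by
  rw [mellin_zphi_eq]
  have hi : IntegrableOn (fun t : ℝ => t ^ (s.re - 1)) (Set.Ioi 1) :=
    integrableOn_Ioi_rpow_of_lt (by linarith) one_pos
  have : ∫ t in Set.Ioi (1:ℝ), t ^ (s.re - 1) = 1 / (-s.re) := by
    rw [integral_Ioi_rpow_of_lt (by linarith) one_pos]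
    simp [div_neg, neg_div]
  rw [← this]
  refine norm_integral_le_of_norm_le hi ?_
  filter_upwards [ae_restrict_mem measurableSet_Ioi] with t ht
  have ht0 : 0 < t := lt_trans one_pos ht
  rw [norm_mul, Complex.norm_real, Real.norm_of_nonneg (Int.fract_nonneg _),
    Complex.norm_cpow_eq_rpow_re_of_pos ht0]
  simp only [Complex.sub_re, Complex.one_re]
  exact mul_le_of_le_one_left (by positivity) (Int.fract_lt_one _).le

lemma zeta1_of_one_lt {s : ℂ} (hs : 1 < s.re) :
    riemannZeta₁ s = s - s * (s - 1) * mellin zphi (-s) := by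
  have hs1 : s ≠ 1 := by rintro rfl; simp at hs
  have hs1' : s - 1 ≠ 0 := sub_ne_zero.mpr hs1
  have hL := LSeries_eq_mul_integral' (1 : ℕ → ℂ) zero_le_one hs (by
    apply Asymptotics.IsBigO.of_bound 1
    filter_upwards with n
    simp)
  rw [LSeries_one_eq_riemannZeta hs, riemannZeta_eq_inv_sub_mul hs1] at hL
  have key : ∫ t in Set.Ioi (1 : ℝ), (∑ k ∈ Finset.Icc 1 ⌊t⌋₊, (1 : ℕ → ℂ) k) * (t:ℂ) ^ (-(s + 1))
      = 1 / (s - 1) - mellin zphi (-s) := by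
    have hre : (-s).re < -1 := by simpa using hs
    have h1 : ∫ t in Set.Ioi (1 : ℝ), (t:ℂ) ^ (-s) = 1 / (s - 1) := by
      rw [integral_Ioi_cpow_of_lt hre one_pos]
      have : -s + 1 ≠ 0 := by intro h; apply hs1'; linear_combination -h
      simp
      field_simp
      ring
    rw [← h1, mellin_zphi_eq, ← integral_sub (integrableOn_Ioi_cpow_of_lt hre one_pos)
      (zphi_integrableOn (by linarith))]
    refine setIntegral_congr_fun measurableSet_Ioi fun t ht => ?_
    have ht0 : (0:ℝ) < t := lt_trans one_pos ht
    have ht0' : (t:ℂ) ≠ 0 := by exact_mod_cast ht0.ne'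
    have hfl : ((⌊t⌋₊ : ℕ) : ℂ) = (t : ℂ) - ((Int.fract t : ℝ) : ℂ) := by
      rw [← Complex.ofReal_sub, Int.self_sub_fract, ← natCast_floor_eq_intCast_floor ht0.le]
      simp
    have hp : (t:ℂ) ^ (-s) = t * (t:ℂ) ^ (-s - 1) := by
      rw [Complex.cpow_sub _ _ ht0', Complex.cpow_one]; field_simp
    simp only [Pi.one_apply, Finset.sum_const, Nat.card_Icc, Nat.add_sub_cancel, nsmul_eq_mul, mul_one]
    rw [hfl, hp, show -(s+1) = -s - 1 by ring]
    ring
  rw [key] at hL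
  field_simp at hL
  rw [hL]
  ring

lemma zeta1_formula {s : ℂ} (hs : 0 < s.re) :
    riemannZeta₁ s = s - s * (s - 1) * mellin zphi (-s) := by
  have ho : IsOpen {s : ℂ | 0 < s.re} := isOpen_lt continuous_const Complex.continuous_re
  have h1 : AnalyticOnNhd ℂ riemannZeta₁ {s : ℂ | 0 < s.re} :=
    differentiable_riemannZeta₁.differentiableOn.analyticOnNhd ho
  have h2 : AnalyticOnNhd ℂ (fun s => s - s * (s - 1) * mellin zphi (-s)) {s : ℂ | 0 < s.re} := by
    apply DifferentiableOn.analyticOnNhd _ ho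
    intro z hz
    apply DifferentiableAt.differentiableWithinAt
    have : DifferentiableAt ℂ (fun s => mellin zphi (-s)) z :=
      DifferentiableAt.comp (g := mellin zphi) z (mellin_zphi_diff (by simpa using hz)) differentiable_neg.differentiableAt
    fun_prop
  have hp : IsPreconnected {s : ℂ | 0 < s.re} := (convex_halfSpace_re_gt 0).isPreconnected
  refine h1.eqOn_of_preconnected_of_eventuallyEq h2 hp (z₀ := 2) (by simp) ?_ hs
  have : {s : ℂ | 1 < s.re} ∈ nhds (2:ℂ) :=
    (isOpen_lt continuous_const Complex.continuous_re).mem_nhds (by simp)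
  filter_upwards [this] with z hz using zeta1_of_one_lt hz

lemma zeta_bound {s : ℂ} (h1 : 1 / 3 ≤ s.re) (h2 : 1 ≤ s.im) : ‖riemannZeta s‖ ≤ 4 * ‖s‖ := by
  have hs1 : s ≠ 1 := by rintro rfl; norm_num at h2
  have hs1' : s - 1 ≠ 0 := sub_ne_zero.mpr hs1
  have hn : 1 ≤ ‖s - 1‖ := by
    refine le_trans ?_ (Complex.abs_im_le_norm _)
    simpa using h2.trans (le_abs_self _)
  have hm := mellin_zphi_bound (s := -s) (by simp; linarith)
  have hm3 : ‖mellin zphi (-s)‖ ≤ 3 := by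
    refine hm.trans ?_
    rw [Complex.neg_re, neg_neg, div_le_iff₀ (by linarith)]; linarith
  rw [riemannZeta_eq_inv_sub_mul hs1, zeta1_formula (by linarith)]
  have : (s - 1)⁻¹ * (s - s * (s - 1) * mellin zphi (-s)) = s * ((s-1)⁻¹ - mellin zphi (-s)) := by
    field_simp
  rw [this]
  rw [norm_mul, mul_comm]
  gcongr
  refine (norm_sub_le _ _).trans ?_
  rw [norm_inv]
  have := inv_le_one_of_one_le₀ hn
  linarith


noncomputable def zE (c : ℝ) (z : ℂ) : ℂ := dslope (fun z => Complex.exp (c * z)) 0 z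

lemma zE_diff (c : ℝ) : Differentiable ℂ (zE c) := by
  rw [← differentiableOn_univ]
  exact (Complex.differentiableOn_dslope Filter.univ_mem).mpr (by fun_prop)

lemma zE_ne (c : ℝ) {z : ℂ} (hz : z ≠ 0) : zE c z = (Complex.exp (c * z) - 1) / z := by
  unfold zE
  rw [dslope_of_ne _ hz, slope_def_field]
  simp

lemma zE_seg (c : ℝ) (y : ℝ) : ‖zE c (y * Complex.I)‖ ≤ |c| := by
  by_cases hy : y = 0
  · subst hy
    have : HasDerivAt (fun z : ℂ => Complex.exp (c * z)) c 0 := by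
      have := ((hasDerivAt_id (0:ℂ)).const_mul (c:ℂ)).cexp
      simpa using this
    simp [zE, dslope_same, this.deriv]
  · have h0 : (y * Complex.I : ℂ) ≠ 0 := by simp [hy]
    rw [zE_ne c h0, norm_div]
    have := Real.norm_exp_I_mul_ofReal_sub_one_le (x := c * y)
    rw [div_le_iff₀ (by simpa using hy)]
    have e : (c:ℂ) * (y * Complex.I) = Complex.I * ((c * y : ℝ) : ℂ) := by push_cast; ring
    rw [e]
    simpa [abs_mul] using this

lemma zpiece (R : Set ℂ) (G Q : ℂ → ℂ) (G0 : ℂ) (c K a b : ℝ) (hab : a ≤ b) (γ : ℝ → ℂ)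
    (hγ : Continuous γ) (hG : ContinuousOn G R) (hQ : ContinuousOn Q R)
    (hR : ∀ x ∈ Set.Icc a b, γ x ∈ R) (h0 : ∀ x ∈ Set.Icc a b, γ x ≠ 0)
    (hQe : ∀ z, z ≠ 0 → Q z = (G z - G0) / z)
    (hK : ∀ x ∈ Set.Icc a b, ‖G (γ x) * Complex.exp (c * γ x) / γ x‖ ≤ K) :
    ‖(∫ x in a..b, G (γ x) * zE c (γ x)) + (∫ x in a..b, Q (γ x)) + G0 * (∫ x in a..b, 1 / γ x)‖
      ≤ K * (b - a) := by
  have i1 : IntervalIntegrable (fun x => G (γ x) * zE c (γ x)) volume a b := by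
    apply ContinuousOn.intervalIntegrable
    rw [Set.uIcc_of_le hab]
    exact (hG.comp hγ.continuousOn hR).mul ((zE_diff c).continuous.comp hγ).continuousOn
  have i2 : IntervalIntegrable (fun x => Q (γ x)) volume a b := by
    apply ContinuousOn.intervalIntegrable
    rw [Set.uIcc_of_le hab]
    exact (hQ.comp hγ.continuousOn hR)
  have i3 : IntervalIntegrable (fun x => G0 * (1 / γ x)) volume a b := by
    apply ContinuousOn.intervalIntegrable
    rw [Set.uIcc_of_le hab]
    exact continuousOn_const.mul (continuousOn_const.div hγ.continuousOn h0)
  rw [← intervalIntegral.integral_const_mul, ← intervalIntegral.integral_add i1 i2,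
    ← intervalIntegral.integral_add (i1.add i2) i3]
  have := intervalIntegral.norm_integral_le_of_norm_le_const (a := a) (b := b) (C := K)
    (f := fun x => G (γ x) * zE c (γ x) + Q (γ x) + G0 * (1 / γ x)) (fun x hx => by
      rw [Set.uIoc_of_le hab] at hx
      have hx' := Set.Ioc_subset_Icc_self hx
      have hz := h0 x hx'
      have e : G (γ x) * zE c (γ x) + Q (γ x) + G0 * (1 / γ x)
          = G (γ x) * Complex.exp (c * γ x) / γ x := by
        rw [zE_ne c hz, hQe _ hz]
        field_simp
        ring
      rw [e]
      exact hK x hx')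
  rwa [abs_of_nonneg (by linarith)] at this

lemma zwind : (1:ℝ)/4 ≤ ‖(∫ x in (-(1/30):ℝ)..(1/30), 1 / ((x:ℂ) + ((-(1/3) : ℝ):ℂ) * Complex.I))
    - (∫ x in (-(1/30):ℝ)..(1/30), 1 / ((x:ℂ) + ((1/3 : ℝ):ℂ) * Complex.I))
    + Complex.I * (∫ y in (-(1/3):ℝ)..(1/3), 1 / (((1/30:ℝ):ℂ) + (y:ℂ) * Complex.I))
    - Complex.I * (∫ y in (-(1/3):ℝ)..(1/3), 1 / (((-(1/30):ℝ):ℂ) + (y:ℂ) * Complex.I))‖ := by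
  have hre : ∀ (r : ℝ), r ≠ 0 → ∀ x : ℝ, (x:ℂ) + (r:ℂ) * Complex.I ≠ 0 := by
    intro r hr x h
    have := congrArg Complex.im h
    simp at this
    exact hr this
  have him : ∀ (r : ℝ), r ≠ 0 → ∀ x : ℝ, (r:ℂ) + (x:ℂ) * Complex.I ≠ 0 := by
    intro r hr x h
    have := congrArg Complex.re h
    simp at this
    exact hr this
  have c1 : ∀ (r : ℝ), r ≠ 0 → ∀ a b : ℝ,
      IntervalIntegrable (fun x : ℝ => 1 / ((x:ℂ) + (r:ℂ) * Complex.I)) volume a b := by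
    intro r hr a b
    apply Continuous.intervalIntegrable
    exact continuous_const.div (by fun_prop) (hre r hr)
  have c2 : ∀ (r : ℝ), r ≠ 0 → ∀ a b : ℝ,
      IntervalIntegrable (fun x : ℝ => 1 / ((r:ℂ) + (x:ℂ) * Complex.I)) volume a b := by
    intro r hr a b
    apply Continuous.intervalIntegrable
    exact continuous_const.div (by fun_prop) (him r hr)
  rw [add_sub_assoc, ← mul_sub, ← intervalIntegral.integral_sub (c1 _ (by norm_num) _ _) (c1 _ (by norm_num) _ _),
    ← intervalIntegral.integral_sub (c2 _ (by norm_num) _ _) (c2 _ (by norm_num) _ _)]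
  have e1 : ∀ x : ℝ, 1 / ((x:ℂ) + ((-(1/3) : ℝ):ℂ) * Complex.I) - 1 / ((x:ℂ) + ((1/3 : ℝ):ℂ) * Complex.I)
      = Complex.I * (((2/3) / (x^2 + 1/9) : ℝ) : ℂ) := by
    intro x
    have h1 := hre (-(1/3)) (by norm_num) x
    have h2 := hre ((1/3)) (by norm_num) x
    have h3 : ((x:ℂ)^2 + 1/9) ≠ 0 := by
      have : ((x^2 + 1/9 : ℝ) : ℂ) ≠ 0 := by
        rw [Complex.ofReal_ne_zero]; positivity
      push_cast at this
      exact this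
    push_cast at *
    rw [div_sub_div _ _ h1 h2, ← mul_div_assoc, div_eq_div_iff (mul_ne_zero h1 h2) h3]
    ring_nf
    simp only [show Complex.I^3 = -Complex.I by rw [pow_succ, Complex.I_sq]; ring]
    ring
  have e2 : ∀ y : ℝ, 1 / (((1/30:ℝ):ℂ) + (y:ℂ) * Complex.I) - 1 / (((-(1/30):ℝ):ℂ) + (y:ℂ) * Complex.I)
      = (((1/15) / (y^2 + 1/900) : ℝ) : ℂ) := by
    intro x
    have h1 := him (-(1/30)) (by norm_num) x
    have h2 := him ((1/30)) (by norm_num) x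
    have h3 : ((x:ℂ)^2 + 1/900) ≠ 0 := by
      have : ((x^2 + 1/900 : ℝ) : ℂ) ≠ 0 := by
        rw [Complex.ofReal_ne_zero]; positivity
      push_cast at this
      exact this
    push_cast at *
    rw [div_sub_div _ _ h2 h1, div_eq_div_iff (mul_ne_zero h2 h1) h3]
    ring_nf
    simp only [Complex.I_sq]
    ring
  simp_rw [e1, e2]
  rw [intervalIntegral.integral_const_mul, intervalIntegral.integral_ofReal, intervalIntegral.integral_ofReal,
    ← mul_add, ← Complex.ofReal_add, norm_mul, Complex.norm_I, one_mul, Complex.norm_real]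
  refine le_trans ?_ (le_abs_self _)
  have p1 : 0 ≤ ∫ x in (-(1/30):ℝ)..(1/30), (2/3) / (x^2 + 1/9) :=
    intervalIntegral.integral_nonneg (by norm_num) (fun x _ => by positivity)
  have p2 : (∫ x in (-(1/3):ℝ)..(1/3), (3/8 : ℝ)) ≤ ∫ x in (-(1/3):ℝ)..(1/3), (1/15) / (x^2 + 1/900) := by
    apply intervalIntegral.integral_mono_on (by norm_num) (by simp)
    · apply Continuous.intervalIntegrable
      exact continuous_const.div (by fun_prop) (fun x => by positivity)
    · intro x hx
      rw [le_div_iff₀ (by positivity)]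
      nlinarith [hx.1, hx.2]
  simp at p1 p2 ⊢
  norm_num at p1 p2 ⊢
  linarith

lemma zlocal (G : ℂ → ℂ) (L : ℝ) (hL : 0 ≤ L)
    (hG : DifferentiableOn ℂ G (Set.Icc (-(1/30)) (1/30) ×ℂ Set.Icc (-(1/3)) (1/3)))
    (hend : ∀ x ∈ Set.Icc (-(1/30):ℝ) (1/30), ‖G (x + ((1/3:ℝ):ℂ) * Complex.I)‖ ≤ 1 ∧
      ‖G (x + ((-(1/3):ℝ):ℂ) * Complex.I)‖ ≤ 1)
    (hside : ∀ y ∈ Set.Icc (-(1/3):ℝ) (1/3),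
      ‖G (((1/30:ℝ):ℂ) + y * Complex.I)‖ * Real.exp (-(L/30)) ≤ 1 ∧
      ‖G (((-(1/30):ℝ):ℂ) + y * Complex.I)‖ * Real.exp (-(L/30)) ≤ 1) :
    ‖G 0‖ ≤ 8 * L * (∫ y in (-(1/3):ℝ)..(1/3), ‖G (y * Complex.I)‖) + 164 := by
  set R : Set ℂ := Set.Icc (-(1/30)) (1/30) ×ℂ Set.Icc (-(1/3)) (1/3) with hRdef
  have hmem : ∀ x y : ℝ, x ∈ Set.Icc (-(1/30):ℝ) (1/30) → y ∈ Set.Icc (-(1/3):ℝ) (1/3) →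
      (x:ℂ) + y * Complex.I ∈ R := by
    intro x y hx hy
    rw [hRdef, Complex.mem_reProdIm]
    exact ⟨by simpa using hx, by simpa using hy⟩
  have hRn : R ∈ nhds (0:ℂ) := by
    have ho : IsOpen ({z : ℂ | -(1/30) < z.re} ∩ {z : ℂ | z.re < 1/30} ∩ {z : ℂ | -(1/3) < z.im} ∩ {z : ℂ | z.im < 1/3}) := by
      refine (((isOpen_lt ?_ ?_).inter (isOpen_lt ?_ ?_)).inter (isOpen_lt ?_ ?_)).inter (isOpen_lt ?_ ?_) <;> fun_prop
    refine Filter.mem_of_superset (ho.mem_nhds (by norm_num)) ?_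
    rintro z ⟨⟨⟨h1, h2⟩, h3⟩, h4⟩
    exact ⟨⟨le_of_lt h1, le_of_lt h2⟩, ⟨le_of_lt h3, le_of_lt h4⟩⟩
  set Q : ℂ → ℂ := dslope G 0 with hQdef
  have hQ : DifferentiableOn ℂ Q R := (Complex.differentiableOn_dslope hRn).mpr hG
  have hQe : ∀ z, z ≠ 0 → Q z = (G z - G 0) / z := by
    intro z hz
    rw [hQdef, dslope_of_ne _ hz, slope_def_field, sub_zero]
  -- the three contour identities
  have c1 := Complex.integral_boundary_rect_eq_zero_of_differentiableOn
    (fun z => G z * zE L z) ⟨-(1/30), -(1/3)⟩ ⟨0, 1/3⟩ (by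
      refine (hG.mul (zE_diff L).differentiableOn).mono ?_
      rw [hRdef, Set.uIcc_of_le (by norm_num), Set.uIcc_of_le (by norm_num)]
      intro z hz
      rw [Complex.mem_reProdIm] at hz ⊢
      exact ⟨⟨hz.1.1, hz.1.2.trans (by norm_num)⟩, hz.2⟩)
  have c2 := Complex.integral_boundary_rect_eq_zero_of_differentiableOn
    (fun z => G z * zE (-L) z) ⟨0, -(1/3)⟩ ⟨1/30, 1/3⟩ (by
      refine (hG.mul (zE_diff (-L)).differentiableOn).mono ?_
      rw [hRdef, Set.uIcc_of_le (by norm_num), Set.uIcc_of_le (by norm_num)]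
      intro z hz
      rw [Complex.mem_reProdIm] at hz ⊢
      exact ⟨⟨le_trans (by norm_num) hz.1.1, hz.1.2⟩, hz.2⟩)
  have c3 := Complex.integral_boundary_rect_eq_zero_of_differentiableOn
    Q ⟨-(1/30), -(1/3)⟩ ⟨1/30, 1/3⟩ (by
      refine hQ.mono ?_
      rw [hRdef, Set.uIcc_of_le (by norm_num), Set.uIcc_of_le (by norm_num)])
  dsimp only at c1 c2 c3
  simp only [smul_eq_mul] at c1 c2 c3
  have hw := zwind
  -- splitting of the horizontal integrals
  have hne : ∀ (r : ℝ), r ≠ 0 → ∀ x : ℝ, (x:ℂ) + (r:ℂ) * Complex.I ≠ 0 := by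
    intro r hr x h
    have := congrArg Complex.im h
    simp at this
    exact hr this
  have hne' : ∀ (r : ℝ), r ≠ 0 → ∀ x : ℝ, (r:ℂ) + (x:ℂ) * Complex.I ≠ 0 := by
    intro r hr x h
    have := congrArg Complex.re h
    simp at this
    exact hr this
  have s1 : ∀ r : ℝ, r ≠ 0 → (∫ x in (-(1/30):ℝ)..(1/30), 1 / ((x:ℂ) + (r:ℂ) * Complex.I)) =
      (∫ x in (-(1/30):ℝ)..0, 1 / ((x:ℂ) + (r:ℂ) * Complex.I)) +
      (∫ x in (0:ℝ)..(1/30), 1 / ((x:ℂ) + (r:ℂ) * Complex.I)) := by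
    intro r hr
    have hc : Continuous (fun x : ℝ => 1 / ((x:ℂ) + (r:ℂ) * Complex.I)) :=
      continuous_const.div (by fun_prop) (hne r hr)
    rw [intervalIntegral.integral_add_adjacent_intervals] <;> exact hc.intervalIntegrable _ _
  have s2 : ∀ r : ℝ, r ∈ Set.Icc (-(1/3):ℝ) (1/3) → (∫ x in (-(1/30):ℝ)..(1/30), Q ((x:ℂ) + (r:ℂ) * Complex.I)) =
      (∫ x in (-(1/30):ℝ)..0, Q ((x:ℂ) + (r:ℂ) * Complex.I)) +
      (∫ x in (0:ℝ)..(1/30), Q ((x:ℂ) + (r:ℂ) * Complex.I)) := by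
    intro r hr
    have hc : ContinuousOn (fun x : ℝ => Q ((x:ℂ) + (r:ℂ) * Complex.I)) (Set.Icc (-(1/30)) (1/30)) :=
      hQ.continuousOn.comp (by fun_prop) (fun x hx => hmem x r hx hr)
    rw [intervalIntegral.integral_add_adjacent_intervals]
    · apply ContinuousOn.intervalIntegrable
      rw [Set.uIcc_of_le (by norm_num)]
      exact hc.mono (Set.Icc_subset_Icc le_rfl (by norm_num))
    · apply ContinuousOn.intervalIntegrable
      rw [Set.uIcc_of_le (by norm_num)]
      exact hc.mono (Set.Icc_subset_Icc (by norm_num) le_rfl)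
  rw [s1 _ (by norm_num), s1 _ (by norm_num)] at hw
  rw [s2 _ (by norm_num), s2 _ (by norm_num)] at c3
  -- bounds
  have bnd : ∀ (z : ℂ) (c A B D : ℝ), 0 ≤ A → ‖G z‖ * Real.exp (c * z.re) ≤ A → 0 < B → B ≤ ‖z‖ → A / B ≤ D →
      ‖G z * Complex.exp (c * z) / z‖ ≤ D := by
    intro z c A B D hA h1 hB h2 h3
    rw [norm_div, norm_mul, Complex.norm_exp]
    have : ((c:ℂ) * z).re = c * z.re := by simp
    rw [this]
    refine le_trans ?_ h3
    gcongr
  have hor : ∀ (r c : ℝ) (x : ℝ), (r = 1/3 ∨ r = -(1/3)) → x ∈ Set.Icc (-(1/30):ℝ) (1/30) → c * x ≤ 0 →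
      ‖G (x + (r:ℂ) * Complex.I) * Complex.exp (c * (x + (r:ℂ) * Complex.I)) / (x + (r:ℂ) * Complex.I)‖ ≤ 3 := by
    intro r c x hr hx hc
    apply bnd _ c 1 (1/3) 3 zero_le_one _ (by norm_num) _ (by norm_num)
    · have h1 : ‖G (x + (r:ℂ) * Complex.I)‖ ≤ 1 := by
        rcases hr with rfl | rfl
        · exact (hend x hx).1
        · exact (hend x hx).2
      have h2 : Real.exp (c * ((x:ℂ) + (r:ℂ) * Complex.I).re) ≤ 1 := by
        rw [Real.exp_le_one_iff]; simpa using hc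
      exact mul_le_one₀ h1 (Real.exp_pos _).le h2
    · refine le_trans ?_ (Complex.abs_im_le_norm _)
      rcases hr with rfl | rfl <;> norm_num
  have m3 : ∀ r : ℝ, (r = 1/3 ∨ r = -(1/3)) → r ∈ Set.Icc (-(1/3):ℝ) (1/3) ∧ r ≠ 0 := by
    rintro r (rfl | rfl) <;> norm_num
  have pl : ∀ r : ℝ, (r = 1/3 ∨ r = -(1/3)) → _ := fun r hr =>
    zpiece R G Q (G 0) L 3 (-(1/30)) 0 (by norm_num) (fun x : ℝ => (x:ℂ) + (r:ℂ) * Complex.I) (by fun_prop)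
      hG.continuousOn hQ.continuousOn
      (fun x hx => hmem x r ⟨hx.1, hx.2.trans (by norm_num)⟩ (m3 r hr).1)
      (fun x _ => hne r (m3 r hr).2 x) hQe
      (fun x hx => hor r L x hr ⟨hx.1, hx.2.trans (by norm_num)⟩ (mul_nonpos_of_nonneg_of_nonpos hL hx.2))
  have pr : ∀ r : ℝ, (r = 1/3 ∨ r = -(1/3)) → _ := fun r hr =>
    zpiece R G Q (G 0) (-L) 3 0 (1/30) (by norm_num) (fun x : ℝ => (x:ℂ) + (r:ℂ) * Complex.I) (by fun_prop)
      hG.continuousOn hQ.continuousOn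
      (fun x hx => hmem x r ⟨le_trans (by norm_num) hx.1, hx.2⟩ (m3 r hr).1)
      (fun x _ => hne r (m3 r hr).2 x) hQe
      (fun x hx => hor r (-L) x hr ⟨le_trans (by norm_num) hx.1, hx.2⟩ (by nlinarith [hx.1]))
  have psl := zpiece R G Q (G 0) L 30 (-(1/3)) (1/3) (by norm_num)
      (fun y : ℝ => ((-(1/30):ℝ):ℂ) + (y:ℂ) * Complex.I) (by fun_prop)
      hG.continuousOn hQ.continuousOn
      (fun y hy => hmem _ y (by norm_num) hy)
      (fun x _ => hne' _ (by norm_num) x) hQe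
      (fun y hy => by
        apply bnd _ _ 1 (1/30) 30 zero_le_one _ (by norm_num) _ (by norm_num)
        · convert (hside y hy).2 using 3
          simp; ring
        · refine le_trans ?_ (Complex.abs_re_le_norm _)
          norm_num)
  have psr := zpiece R G Q (G 0) (-L) 30 (-(1/3)) (1/3) (by norm_num)
      (fun y : ℝ => ((1/30:ℝ):ℂ) + (y:ℂ) * Complex.I) (by fun_prop)
      hG.continuousOn hQ.continuousOn
      (fun y hy => hmem _ y (by norm_num) hy)
      (fun x _ => hne' _ (by norm_num) x) hQe
      (fun y hy => by
        apply bnd _ _ 1 (1/30) 30 zero_le_one _ (by norm_num) _ (by norm_num)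
        · convert (hside y hy).1 using 3
          simp; ring
        · refine le_trans ?_ (Complex.abs_re_le_norm _)
          norm_num)
  -- the middle segment
  have hGc : ContinuousOn (fun y : ℝ => G (y * Complex.I)) (Set.Icc (-(1/3)) (1/3)) :=
    hG.continuousOn.comp (by fun_prop) (fun y hy => by simpa using hmem 0 y (by norm_num) hy)
  have seg : ∀ c : ℝ, |c| = L → ‖∫ y in (-(1/3):ℝ)..(1/3), G (((0:ℝ):ℂ) + y * Complex.I) * zE c (((0:ℝ):ℂ) + y * Complex.I)‖
      ≤ L * (∫ y in (-(1/3):ℝ)..(1/3), ‖G (y * Complex.I)‖) := by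
    intro c hc
    rw [← intervalIntegral.integral_const_mul]
    apply intervalIntegral.norm_integral_le_of_norm_le (by norm_num)
    · filter_upwards with y hy
      rw [Complex.ofReal_zero, zero_add, norm_mul, mul_comm, ← hc]
      gcongr
      exact zE_seg c y
    · apply ContinuousOn.intervalIntegrable
      rw [Set.uIcc_of_le (by norm_num)]
      exact continuousOn_const.mul hGc.norm
  have sg1 := seg L (abs_of_nonneg hL)
  have sg2 := seg (-L) (by rw [abs_neg, abs_of_nonneg hL])
  have plt := pl (1/3) (Or.inl rfl)
  have plb := pl (-(1/3)) (Or.inr rfl)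
  have prt := pr (1/3) (Or.inl rfl)
  have prb := pr (-(1/3)) (Or.inr rfl)
  clear pl pr seg
  generalize (∫ y in (-(1/3):ℝ)..(1/3), ‖G (y * Complex.I)‖) = S at *
  revert c1 c2 c3 hw sg1 sg2 plt plb prt prb psl psr
  generalize (∫ x in (-(1/30):ℝ)..0, G ((x:ℂ) + ((-(1/3):ℝ):ℂ) * Complex.I) * zE L ((x:ℂ) + ((-(1/3):ℝ):ℂ) * Complex.I)) = a1
  generalize (∫ x in (-(1/30):ℝ)..0, G ((x:ℂ) + ((1/3:ℝ):ℂ) * Complex.I) * zE L ((x:ℂ) + ((1/3:ℝ):ℂ) * Complex.I)) = a2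
  generalize (∫ x in (0:ℝ)..(1/30), G ((x:ℂ) + ((-(1/3):ℝ):ℂ) * Complex.I) * zE (-L) ((x:ℂ) + ((-(1/3):ℝ):ℂ) * Complex.I)) = a3
  generalize (∫ x in (0:ℝ)..(1/30), G ((x:ℂ) + ((1/3:ℝ):ℂ) * Complex.I) * zE (-L) ((x:ℂ) + ((1/3:ℝ):ℂ) * Complex.I)) = a4
  generalize (∫ y in (-(1/3):ℝ)..(1/3), G (((0:ℝ):ℂ) + y * Complex.I) * zE L (((0:ℝ):ℂ) + y * Complex.I)) = a5
  generalize (∫ y in (-(1/3):ℝ)..(1/3), G (((0:ℝ):ℂ) + y * Complex.I) * zE (-L) (((0:ℝ):ℂ) + y * Complex.I)) = a6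
  generalize (∫ y in (-(1/3):ℝ)..(1/3), G (((1/30:ℝ):ℂ) + y * Complex.I) * zE (-L) (((1/30:ℝ):ℂ) + y * Complex.I)) = a7
  generalize (∫ y in (-(1/3):ℝ)..(1/3), G (((-(1/30):ℝ):ℂ) + y * Complex.I) * zE L (((-(1/30):ℝ):ℂ) + y * Complex.I)) = a8
  generalize (∫ x in (-(1/30):ℝ)..0, Q ((x:ℂ) + ((-(1/3):ℝ):ℂ) * Complex.I)) = q1
  generalize (∫ x in (-(1/30):ℝ)..0, Q ((x:ℂ) + ((1/3:ℝ):ℂ) * Complex.I)) = q2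
  generalize (∫ x in (0:ℝ)..(1/30), Q ((x:ℂ) + ((-(1/3):ℝ):ℂ) * Complex.I)) = q3
  generalize (∫ x in (0:ℝ)..(1/30), Q ((x:ℂ) + ((1/3:ℝ):ℂ) * Complex.I)) = q4
  generalize (∫ y in (-(1/3):ℝ)..(1/3), Q (((1/30:ℝ):ℂ) + y * Complex.I)) = q7
  generalize (∫ y in (-(1/3):ℝ)..(1/3), Q (((-(1/30):ℝ):ℂ) + y * Complex.I)) = q8
  generalize (∫ x in (-(1/30):ℝ)..0, 1 / ((x:ℂ) + ((-(1/3):ℝ):ℂ) * Complex.I)) = w1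
  generalize (∫ x in (-(1/30):ℝ)..0, 1 / ((x:ℂ) + ((1/3:ℝ):ℂ) * Complex.I)) = w2
  generalize (∫ x in (0:ℝ)..(1/30), 1 / ((x:ℂ) + ((-(1/3):ℝ):ℂ) * Complex.I)) = w3
  generalize (∫ x in (0:ℝ)..(1/30), 1 / ((x:ℂ) + ((1/3:ℝ):ℂ) * Complex.I)) = w4
  generalize (∫ y in (-(1/3):ℝ)..(1/3), 1 / (((1/30:ℝ):ℂ) + y * Complex.I)) = w7
  generalize (∫ y in (-(1/3):ℝ)..(1/3), 1 / (((-(1/30):ℝ):ℂ) + y * Complex.I)) = w8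
  generalize G 0 = g
  intro c1 c2 c3 hw sg1 sg2 psl psr plt plb prt prb
  have key : g * (w1 + w3 - (w2 + w4) + Complex.I * w7 - Complex.I * w8) =
      (a1 + q1 + g * w1) - (a2 + q2 + g * w2) + (a3 + q3 + g * w3) - (a4 + q4 + g * w4)
      + Complex.I * (a7 + q7 + g * w7) - Complex.I * (a8 + q8 + g * w8)
      + Complex.I * a5 - Complex.I * a6 := by
    linear_combination -c1 - c2 - c3
  have hn := congrArg norm key
  rw [norm_mul] at hn
  have n1 : ∀ x y : ℂ, ‖x + y‖ ≤ ‖x‖ + ‖y‖ := norm_add_le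
  have n2 : ∀ x y : ℂ, ‖x - y‖ ≤ ‖x‖ + ‖y‖ := norm_sub_le
  have tri : ∀ x1 x2 x3 x4 x5 x6 x7 x8 : ℂ, ‖x1 - x2 + x3 - x4 + Complex.I * x5 - Complex.I * x6 + Complex.I * x7 - Complex.I * x8‖
      ≤ ‖x1‖ + ‖x2‖ + ‖x3‖ + ‖x4‖ + ‖x5‖ + ‖x6‖ + ‖x7‖ + ‖x8‖ := by
    intro x1 x2 x3 x4 x5 x6 x7 x8
    have hI : ∀ x : ℂ, ‖Complex.I * x‖ = ‖x‖ := by intro x; simp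
    rw [← hI x5, ← hI x6, ← hI x7, ← hI x8]
    refine (n2 _ _).trans (add_le_add_left ((n1 _ _).trans (add_le_add_left ((n2 _ _).trans (add_le_add_left
      ((n1 _ _).trans (add_le_add_left ((n2 _ _).trans (add_le_add_left ((n1 _ _).trans (add_le_add_left
      (n2 _ _) _)) _)) _)) _)) _)) _)
  have ht := tri (a1 + q1 + g * w1) (a2 + q2 + g * w2) (a3 + q3 + g * w3) (a4 + q4 + g * w4)
    (a7 + q7 + g * w7) (a8 + q8 + g * w8) a5 a6
  rw [← hn] at ht
  have hg := mul_le_mul_of_nonneg_left hw (norm_nonneg g)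
  norm_num at plt plb prt prb psl psr
  linarith

/-- Pointwise bound of `|ζ(1/2+it)|^k` by its integral over a short interval:
`|ζ(1/2+it)|^k ≤ C_k (log t ∫_{t-1/3}^{t+1/3} |ζ(1/2+iu)|^k du + 1)` for `t ≥ 2`. -/
theorem zeta_pointwise_by_short_interval (k : ℕ) (hk : 0 < k) :
    ∃ C : ℝ, 0 < C ∧ ∀ t : ℝ, 2 ≤ t →
      ‖riemannZeta (1 / 2 + Complex.I * (t : ℂ))‖ ^ k ≤
        C * (Real.log t *
            (∫ u in (t - 1 / 3)..(t + 1 / 3), ‖riemannZeta (1 / 2 + Complex.I * (u : ℂ))‖ ^ k) + 1) := by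
  refine ⟨240 * (12 * k + 2) + 164, by positivity, fun t ht => ?_⟩
  set ℓ := Real.log t with hℓ
  have hℓ2 : 1 / 2 ≤ ℓ := by
    have h1 := Real.log_two_gt_d9
    have h2 := Real.log_le_log two_pos ht
    linarith
  have hkℓ : 0 ≤ (k:ℝ) * ℓ := by positivity
  set N : ℕ := ⌈8 * k * ℓ⌉₊ with hN
  have hN1 : 8 * k * ℓ ≤ N := Nat.le_ceil _
  have hN2 : (N:ℝ) < 8 * k * ℓ + 1 := Nat.ceil_lt_add_one (by positivity)
  set L : ℝ := 30 * (4 * k * ℓ + N) with hL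
  set s0 : ℂ := 1 / 2 + Complex.I * (t : ℂ) with hs0
  have s0re : s0.re = 1/2 := by simp [hs0]
  have s0im : s0.im = t := by simp [hs0]
  set R : Set ℂ := Set.Icc (-(1/30)) (1/30) ×ℂ Set.Icc (-(1/3)) (1/3) with hR
  have hne : ∀ z ∈ R, s0 + z ≠ 1 := by
    intro z hz h
    have := congrArg Complex.im h
    rw [Complex.add_im, s0im, Complex.one_im] at this
    have := hz.2.1
    linarith
  have hzb : ∀ z ∈ R, ‖riemannZeta (s0 + z) ^ k‖ ≤ Real.exp (4 * k * ℓ) := by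
    intro z hz
    obtain ⟨⟨h1, h2⟩, ⟨h3, h4⟩⟩ := hz
    have hb := zeta_bound (s := s0 + z) (by rw [Complex.add_re, s0re]; linarith)
      (by rw [Complex.add_im, s0im]; linarith)
    have hn : ‖s0 + z‖ ≤ t + 1 := by
      refine (Complex.norm_le_abs_re_add_abs_im _).trans ?_
      rw [Complex.add_re, Complex.add_im, s0re, s0im, abs_of_nonneg (by linarith), abs_of_nonneg (by linarith)]
      linarith
    have h5 : ‖riemannZeta (s0 + z)‖ ≤ t ^ 4 := by
      have h8 : 8 ≤ t ^ 3 := by nlinarith [mul_self_nonneg t, mul_nonneg (by linarith : 0 ≤ t - 2) (by positivity : 0 ≤ t ^ 2)]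
      have : t ^ 4 = t ^ 3 * t := by ring
      nlinarith
    have h6 : Real.exp (4 * k * ℓ) = (t ^ 4) ^ k := by
      rw [← Real.exp_log (show 0 < (t^4)^k by positivity), Real.log_pow, Real.log_pow]
      congr 1
      push_cast
      ring
    rw [norm_pow, h6]
    gcongr
  have hmem : ∀ x y : ℝ, x ∈ Set.Icc (-(1/30):ℝ) (1/30) → y ∈ Set.Icc (-(1/3):ℝ) (1/3) →
      (x:ℂ) + y * Complex.I ∈ R := by
    intro x y hx hy
    rw [hR, Complex.mem_reProdIm]
    exact ⟨by simpa using hx, by simpa using hy⟩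
  have hhalf : (1/2:ℝ) ≤ Real.exp (-(1/2)) := by
    have := Real.add_one_le_exp (-(1/2) : ℝ)
    linarith
  have hendN : ∀ x r : ℝ, x ∈ Set.Icc (-(1/30):ℝ) (1/30) → (r = 1/3 ∨ r = -(1/3)) →
      ‖(1 + 9 * ((x:ℂ) + r * Complex.I) ^ 2) ^ N‖ ≤ Real.exp (-(4 * k * ℓ)) := by
    intro x r hx hr
    have hr2 : (r:ℂ)^2 = 1/9 := by rcases hr with rfl | rfl <;> norm_num
    have hra : |r| = 1/3 := by rcases hr with rfl | rfl <;> norm_num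
    have e : 1 + 9 * ((x:ℂ) + r * Complex.I) ^ 2 = (x:ℂ) * (((9 * x : ℝ) : ℂ) + ((18 * r : ℝ) : ℂ) * Complex.I) := by
      push_cast
      linear_combination 9 * (r:ℂ)^2 * Complex.I_sq - 9 * hr2
    have hx' : |x| ≤ 1/30 := abs_le.mpr hx
    have h1 : ‖1 + 9 * ((x:ℂ) + r * Complex.I) ^ 2‖ ≤ 1/2 := by
      rw [e, norm_mul, Complex.norm_real, Real.norm_eq_abs]
      have : ‖(((9 * x : ℝ) : ℂ) + ((18 * r : ℝ) : ℂ) * Complex.I)‖ ≤ 9 * |x| + 6 := by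
        refine (norm_add_le _ _).trans ?_
        rw [norm_mul, Complex.norm_I, mul_one, Complex.norm_real, Complex.norm_real, Real.norm_eq_abs,
          Real.norm_eq_abs, abs_mul, abs_mul, hra]
        norm_num
      nlinarith [abs_nonneg x, norm_nonneg (((9 * x : ℝ) : ℂ) + ((18 * r : ℝ) : ℂ) * Complex.I)]
    rw [norm_pow]
    calc ‖1 + 9 * ((x:ℂ) + r * Complex.I) ^ 2‖ ^ N ≤ (Real.exp (-(1/2))) ^ N := by
          gcongr; exact h1.trans hhalf
      _ = Real.exp (N * (-(1/2))) := (Real.exp_nat_mul _ _).symm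
      _ ≤ _ := by rw [Real.exp_le_exp]; linarith
  have hsideN : ∀ z ∈ R, ‖(1 + 9 * z ^ 2) ^ N‖ ≤ Real.exp N := by
    intro z hz
    obtain ⟨⟨h1, h2⟩, ⟨h3, h4⟩⟩ := hz
    have hz1 : ‖z‖ ^ 2 ≤ 1/900 + 1/9 := by
      rw [← Complex.normSq_eq_norm_sq, Complex.normSq_apply]; nlinarith
    have h5 : ‖1 + 9 * z ^ 2‖ ≤ Real.exp 1 := by
      have h6 := Real.exp_one_gt_d9
      have h7 := norm_add_le (1:ℂ) (9 * z ^ 2)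
      rw [norm_mul, norm_pow, norm_one] at h7
      norm_num at h7
      linarith
    rw [norm_pow]
    calc ‖1 + 9 * z ^ 2‖ ^ N ≤ (Real.exp 1) ^ N := by gcongr
      _ = _ := by rw [← Real.exp_nat_mul, mul_one]
  have main := zlocal (fun z => riemannZeta (s0 + z) ^ k * (1 + 9 * z ^ 2) ^ N) L (by positivity) (by
      intro z hz
      apply DifferentiableAt.differentiableWithinAt
      have : DifferentiableAt ℂ (fun z => riemannZeta (s0 + z)) z :=
        DifferentiableAt.comp (g := riemannZeta) z (differentiableAt_riemannZeta (hne z hz)) (by fun_prop)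
      fun_prop) (by
      have : ∀ x r : ℝ, x ∈ Set.Icc (-(1/30):ℝ) (1/30) → (r = 1/3 ∨ r = -(1/3)) →
          ‖riemannZeta (s0 + ((x:ℂ) + r * Complex.I)) ^ k * (1 + 9 * ((x:ℂ) + r * Complex.I) ^ 2) ^ N‖ ≤ 1 := by
        intro x r hx hr
        rw [norm_mul]
        refine (mul_le_mul (hzb _ (hmem x r hx (by rcases hr with rfl | rfl <;> norm_num))) (hendN x r hx hr)
          (norm_nonneg _) (Real.exp_pos _).le).trans ?_
        rw [← Real.exp_add]; simp
      exact fun x hx => ⟨this x _ hx (Or.inl rfl), this x _ hx (Or.inr rfl)⟩) (by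
      have : ∀ z ∈ R, ‖riemannZeta (s0 + z) ^ k * (1 + 9 * z ^ 2) ^ N‖ * Real.exp (-(L/30)) ≤ 1 := by
        intro z hz
        rw [norm_mul]
        refine (mul_le_mul_of_nonneg_right (mul_le_mul (hzb z hz) (hsideN z hz)
          (norm_nonneg _) (Real.exp_pos _).le) (Real.exp_pos _).le).trans ?_
        rw [← Real.exp_add, ← Real.exp_add, Real.exp_le_one_iff, hL]
        linarith
      exact fun y hy => ⟨this _ (hmem _ y (by norm_num) hy), this _ (hmem _ y (by norm_num) hy)⟩)
  have hcz : ContinuousOn (fun y : ℝ => riemannZeta (s0 + y * Complex.I)) (Set.Icc (-(1/3)) (1/3)) := by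
    intro y hy
    apply ContinuousAt.continuousWithinAt
    have := (differentiableAt_riemannZeta (hne _ (hmem 0 y (by norm_num) hy))).continuousAt
    rw [Complex.ofReal_zero, zero_add] at this
    exact ContinuousAt.comp (f := fun y : ℝ => s0 + y * Complex.I) this (by fun_prop)
  have hint : (∫ y in (-(1/3):ℝ)..(1/3), ‖riemannZeta (s0 + y * Complex.I) ^ k * (1 + 9 * ((y:ℂ) * Complex.I) ^ 2) ^ N‖)
      ≤ ∫ u in (t - 1 / 3)..(t + 1 / 3), ‖riemannZeta (1 / 2 + Complex.I * (u : ℂ))‖ ^ k := by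
    have e : ∫ u in (t - 1 / 3)..(t + 1 / 3), ‖riemannZeta (1 / 2 + Complex.I * (u : ℂ))‖ ^ k
        = ∫ y in (-(1/3):ℝ)..(1/3), ‖riemannZeta (s0 + y * Complex.I)‖ ^ k := by
      rw [sub_eq_add_neg, ← intervalIntegral.integral_comp_add_left
        (fun u : ℝ => ‖riemannZeta (1 / 2 + Complex.I * (u : ℂ))‖ ^ k) t]
      apply intervalIntegral.integral_congr
      intro y _
      dsimp only
      rw [hs0]
      push_cast
      congr 3
      ring
    rw [e]
    apply intervalIntegral.integral_mono_on (by norm_num)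
    · apply ContinuousOn.intervalIntegrable
      rw [Set.uIcc_of_le (by norm_num)]
      exact ((hcz.pow k).mul (by fun_prop)).norm
    · apply ContinuousOn.intervalIntegrable
      rw [Set.uIcc_of_le (by norm_num)]
      exact hcz.norm.pow k
    · intro y hy
      rw [norm_mul, norm_pow, norm_pow]
      refine mul_le_of_le_one_right (by positivity) (pow_le_one₀ (norm_nonneg _) ?_)
      have : 1 + 9 * ((y:ℂ) * Complex.I) ^ 2 = ((1 - 9 * y^2 : ℝ) : ℂ) := by
        rw [mul_pow, Complex.I_sq]; push_cast; ring
      rw [this, Complex.norm_real, Real.norm_eq_abs, abs_le]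
      constructor <;> nlinarith [hy.1, hy.2]
  have e0 : ‖riemannZeta (s0 + 0) ^ k * (1 + 9 * (0:ℂ) ^ 2) ^ N‖ = ‖riemannZeta s0‖ ^ k := by
    simp
  rw [e0] at main
  set J := ∫ u in (t - 1 / 3)..(t + 1 / 3), ‖riemannZeta (1 / 2 + Complex.I * (u : ℂ))‖ ^ k with hJ
  have hJ0 : 0 ≤ J := intervalIntegral.integral_nonneg (by linarith) (fun u _ => by positivity)
  have hL0 : 0 ≤ L := by positivity
  have hL1 : L ≤ 30 * (12 * k + 2) * ℓ := by rw [hL]; linarith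
  have f1 : 8 * L * (∫ y in (-(1/3):ℝ)..(1/3), ‖riemannZeta (s0 + y * Complex.I) ^ k * (1 + 9 * ((y:ℂ) * Complex.I) ^ 2) ^ N‖)
      ≤ 8 * (30 * (12 * k + 2) * ℓ) * J := by
    gcongr
    exact intervalIntegral.integral_nonneg (by norm_num) (fun y _ => norm_nonneg _)
  have f2 : 0 ≤ ℓ * J := by positivity
  have f3 : 0 ≤ 240 * (12 * (k:ℝ) + 2) := by positivity
  nlinarith
end
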